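/- (Sherstov's theorem, lower bound.) There exists a universal constant c > 0 such that for every integer n ≥ 2 and every predicate D : {0,1,...,n} → {−1,1}, the 2^n × 2^n sign matrix F indexed by x, y ∈ {0,1}^n with entries F(x,y) = D(|x ∧ y|) satisfies log₂ rk±(F) ≥ c · deg(D) / (log₂ n)^5, where deg(D) = |{i ∈ {0,...,n−1} : D(i) ≠ D(i+1)}| is the number of sign changes of D. -/

import Mathlib

/-- Hamming weight of a Boolean vector. -/
def hamW {n : ℕ} (x : Fin n → Bool) : ℕ := (Finset.univ.filter (fun i => x i)).card

/-- Bitwise XOR of Boolean vectors. -/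
def bxor {n : ℕ} (x y : Fin n → Bool) : Fin n → Bool := fun i => xor (x i) (y i)

/-- Bitwise AND of Boolean vectors. -/
def band {n : ℕ} (x y : Fin n → Bool) : Fin n → Bool := fun i => x i && y i

/-- Sign-rank of a real sign matrix `F`: the least rank of a real matrix `A`
of the same dimensions all of whose entries are nonzero and have the same sign
as the corresponding entry of `F`. -/
noncomputable def signRank {X Y : Type} [Fintype X] [Fintype Y]
    (F : Matrix X Y ℝ) : ℕ :=
  sInf {r : ℕ | ∃ A : Matrix X Y ℝ, (∀ x y, 0 < A x y * F x y) ∧ A.rank = r}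

/-- Rank factorization of a real matrix. -/
theorem exists_rank_factorization {X Y : Type*} [Fintype X] [Fintype Y] (A : Matrix X Y ℝ) :
    ∃ (U : X → Fin A.rank → ℝ) (V : Y → Fin A.rank → ℝ),
      ∀ x y, A x y = ∑ i, U x i * V y i := by
  classical
  let S := Submodule.span ℝ (Set.range A.col)
  have hS : Module.finrank ℝ S = A.rank := (A.rank_eq_finrank_span_cols).symm
  let b : Module.Basis (Fin A.rank) ℝ S := Module.finBasisOfFinrankEq ℝ S hS
  refine ⟨fun x i => (b i : X → ℝ) x,
    fun y i => b.repr ⟨A.col y, Submodule.subset_span ⟨y, rfl⟩⟩ i, fun x y => ?_⟩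
  have h := b.sum_repr ⟨A.col y, Submodule.subset_span ⟨y, rfl⟩⟩
  have h2 := congrFun (congrArg (Subtype.val) h) x
  simp only [Submodule.coe_sum, Submodule.coe_smul, Finset.sum_apply, Pi.smul_apply,
    smul_eq_mul, Matrix.col_apply] at h2
  rw [← h2]
  exact Finset.sum_congr rfl fun i _ => mul_comm _ _

open Matrix in
theorem det_sq_le_frobenius {r : ℕ} (T : Matrix (Fin r) (Fin r) ℝ) :
    T.det ^ 2 ≤ ((r.factorial : ℝ) ^ 2) * (∑ i, ∑ j, T i j ^ 2) ^ r := by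
  set s := ∑ i, ∑ j, T i j ^ 2 with hs
  have hs0 : 0 ≤ s := Finset.sum_nonneg fun i _ => Finset.sum_nonneg fun j _ => sq_nonneg _
  have h1 : ∀ i j, AbsoluteValue.abs (T i j) ≤ Real.sqrt s := by
    intro i j
    apply Real.abs_le_sqrt
    calc T i j ^ 2 ≤ ∑ j, T i j ^ 2 :=
          Finset.single_le_sum (f := fun j => T i j ^ 2) (fun _ _ => sq_nonneg _)
            (Finset.mem_univ j)
      _ ≤ s := Finset.single_le_sum (f := fun i => ∑ j, T i j ^ 2)
          (fun _ _ => Finset.sum_nonneg fun _ _ => sq_nonneg _) (Finset.mem_univ i)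
  have h2 := Matrix.det_le h1
  simp only [AbsoluteValue.abs_apply, Fintype.card_fin, nsmul_eq_mul] at h2
  calc T.det ^ 2 = |T.det| ^ 2 := (sq_abs _).symm
    _ ≤ ((r.factorial : ℝ) * Real.sqrt s ^ r) ^ 2 := by gcongr
    _ = (r.factorial : ℝ) ^ 2 * (Real.sqrt s ^ 2) ^ r := by ring
    _ = _ := by rw [Real.sq_sqrt hs0]

open Matrix in
/-- A rescaling of finitely many vectors that is nearly isotropic from below, with a small multiple
of the identity added to the covariance of each vector. -/
theorem exists_nearly_isotropic {X : Type*} [Fintype X] [Nonempty X] {r : ℕ} (hr : 0 < r)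
    (U : X → Fin r → ℝ) {ε : ℝ} (hε : 0 < ε) :
    ∃ T : Matrix (Fin r) (Fin r) ℝ, T.det ≠ 0 ∧
      (∀ x, 0 < ∑ i, (T *ᵥ U x) i ^ 2 + ε * ∑ i, ∑ j, T i j ^ 2) ∧
      ∀ v : Fin r → ℝ, (Fintype.card X : ℝ) / (2 * r) * ∑ i, v i ^ 2 ≤
        ∑ x, (((T *ᵥ U x) ⬝ᵥ v) ^ 2 + ε * ∑ j, (v ᵥ* T) j ^ 2) /
          (∑ i, (T *ᵥ U x) i ^ 2 + ε * ∑ i, ∑ j, T i j ^ 2) := by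
  classical
  set F : Matrix (Fin r) (Fin r) ℝ → ℝ := fun T => ∑ i, ∑ j, T i j ^ 2 with hF
  set N : Matrix (Fin r) (Fin r) ℝ → X → ℝ := fun T x => ∑ i, (T *ᵥ U x) i ^ 2 + ε * F T with hN
  set Φ : Matrix (Fin r) (Fin r) ℝ → ℝ := fun T =>
    Fintype.card X * Real.log (T.det ^ 2) - r * ∑ x, Real.log (N T x) with hΦ
  have hX : (0 : ℝ) < Fintype.card X := by exact_mod_cast Fintype.card_pos
  have hr' : (0 : ℝ) < r := by exact_mod_cast hr
  have hF0 : ∀ T, 0 ≤ F T := fun T =>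
    Finset.sum_nonneg fun i _ => Finset.sum_nonneg fun j _ => sq_nonneg _
  have hFpos : ∀ T : Matrix (Fin r) (Fin r) ℝ, T.det ≠ 0 → 0 < F T := by
    intro T hT
    rcases (hF0 T).lt_or_eq with h | h
    · exact h
    · exfalso
      have h2 := det_sq_le_frobenius T
      have : (∑ i, ∑ j, T i j ^ 2) = 0 := h.symm
      rw [this, zero_pow hr.ne', mul_zero] at h2
      have := pow_eq_zero_iff (two_ne_zero) |>.1 (le_antisymm h2 (sq_nonneg _))
      exact hT this
  have hNle : ∀ T x, ε * F T ≤ N T x := fun T x =>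
    le_add_of_nonneg_left (Finset.sum_nonneg fun i _ => sq_nonneg _)
  have hNpos : ∀ T x, T.det ≠ 0 → 0 < N T x := fun T x hT =>
    lt_of_lt_of_le (mul_pos hε (hFpos T hT)) (hNle T x)
  set B : ℝ := Fintype.card X * Real.log ((r.factorial : ℝ) ^ 2) -
    r * (Fintype.card X * Real.log ε) with hB
  have hbound : ∀ T : Matrix (Fin r) (Fin r) ℝ, T.det ≠ 0 → Φ T ≤ B := by
    intro T hT
    have h1 : Real.log (T.det ^ 2) ≤ Real.log ((r.factorial : ℝ) ^ 2) + r * Real.log (F T) := by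
      rw [← Real.log_pow, ← Real.log_mul (by positivity) (pow_pos (hFpos T hT) r).ne']
      exact Real.log_le_log (by positivity) (det_sq_le_frobenius T)
    have h2 : ∑ x : X, (Real.log ε + Real.log (F T)) ≤ ∑ x, Real.log (N T x) := by
      refine Finset.sum_le_sum fun x _ => ?_
      rw [← Real.log_mul hε.ne' (hFpos T hT).ne']
      exact Real.log_le_log (mul_pos hε (hFpos T hT)) (hNle T x)
    simp only [Finset.sum_const, Finset.card_univ, nsmul_eq_mul] at h2
    have h3 := mul_le_mul_of_nonneg_left h1 hX.le
    have h4 := mul_le_mul_of_nonneg_left h2 hr'.le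
    simp only [hΦ, hB]
    nlinarith
  set 𝒮 : Set ℝ := Φ '' {T | T.det ≠ 0} with h𝒮
  have hne : 𝒮.Nonempty := ⟨Φ 1, 1, by simp, rfl⟩
  have hbdd : BddAbove 𝒮 := ⟨B, by rintro _ ⟨T, hT, rfl⟩; exact hbound T hT⟩
  have hδ : 0 < Fintype.card X * (Real.log 2 - 1 / 2) :=
    mul_pos hX (by linarith [Real.log_two_gt_d9])
  obtain ⟨_, ⟨T, hT, rfl⟩, hTsup⟩ := exists_lt_of_lt_csSup hne
    (sub_lt_self (sSup 𝒮) hδ)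
  have hT : T.det ≠ 0 := hT
  refine ⟨T, hT, fun x => hNpos T x hT, fun v => ?_⟩
  set q := ∑ i, v i ^ 2 with hq
  have hq0 : 0 ≤ q := Finset.sum_nonneg fun i _ => sq_nonneg _
  rcases hq0.eq_or_lt with hq0 | hq0
  · rw [← hq0, mul_zero]
    refine Finset.sum_nonneg fun x _ => div_nonneg ?_ (hNpos T x hT).le
    have : 0 ≤ ∑ j, (v ᵥ* T) j ^ 2 := Finset.sum_nonneg fun i _ => sq_nonneg _
    positivity
  set α : ℝ := (Real.sqrt 2 - 1) / q with hα
  have hαq : (1 + α * q) ^ 2 = 2 := by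
    rw [hα, div_mul_cancel₀ _ hq0.ne']
    ring_nf; exact Real.sq_sqrt (by norm_num)
  set T' : Matrix (Fin r) (Fin r) ℝ := T + α • vecMulVec v (v ᵥ* T) with hT'
  have hdet : T'.det ^ 2 = 2 * T.det ^ 2 := by
    have : T' = (1 + vecMulVec v (α • v)) * T := by
      rw [hT', add_mul, one_mul, vecMulVec_mul, smul_vecMul, vecMulVec_smul]
    have h5 : (1 + vecMulVec v (α • v)).det = 1 + α * q := by
      have := det_one_add_replicateCol_mul_replicateRow (ι := Unit) v (α • v)
      rw [← vecMulVec_eq] at this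
      rw [this]
      simp only [dotProduct, Pi.smul_apply, smul_eq_mul, hq, Finset.mul_sum]
      congr 1
      exact Finset.sum_congr rfl fun i _ => by ring
    rw [this, det_mul, mul_pow, h5, hαq]
  have hT'0 : T'.det ≠ 0 := by
    intro h
    rw [h] at hdet
    have : T.det ^ 2 = 0 := by nlinarith
    exact hT (pow_eq_zero_iff two_ne_zero |>.1 this)
  have hsq : ∀ w : Fin r → ℝ, ∀ c : ℝ, c = w ⬝ᵥ v →
      ∑ i, (w i + α * c * v i) ^ 2 = ∑ i, w i ^ 2 + c ^ 2 / q := by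
    intro w c hc
    have h6 : ∑ i, (w i + α * c * v i) ^ 2 =
        ∑ i, w i ^ 2 + 2 * α * c * (w ⬝ᵥ v) + (α * c) ^ 2 * q := by
      simp only [dotProduct, hq, Finset.mul_sum, ← Finset.sum_add_distrib]
      exact Finset.sum_congr rfl fun i _ => by ring
    rw [h6, ← hc]
    have h7 : 2 * α + α ^ 2 * q = 1 / q := by
      rw [eq_div_iff hq0.ne']; nlinarith
    have : c ^ 2 / q = c ^ 2 * (1 / q) := by ring
    rw [this, ← h7]; ring
  have hN' : ∀ x, N T' x = N T x +
      (((T *ᵥ U x) ⬝ᵥ v) ^ 2 + ε * ∑ j, (v ᵥ* T) j ^ 2) / q := by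
    intro x
    have e1 : ∑ i, (T' *ᵥ U x) i ^ 2 =
        ∑ i, (T *ᵥ U x) i ^ 2 + ((T *ᵥ U x) ⬝ᵥ v) ^ 2 / q := by
      rw [← hsq _ _ rfl]
      refine Finset.sum_congr rfl fun i _ => ?_
      congr 1
      rw [hT', add_mulVec, smul_mulVec, vecMulVec_mulVec, ← dotProduct_mulVec]
      simp only [Pi.add_apply, Pi.smul_apply, smul_eq_mul, MulOpposite.smul_eq_mul_unop,
        MulOpposite.unop_op, dotProduct_comm v]
      ring
    have e2 : F T' = F T + (∑ j, (v ᵥ* T) j ^ 2) / q := by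
      simp only [hF]
      rw [Finset.sum_comm, Finset.sum_comm (f := fun i j => T i j ^ 2), Finset.sum_div,
        ← Finset.sum_add_distrib]
      refine Finset.sum_congr rfl fun j _ => ?_
      rw [← hsq (fun i => T i j) ((v ᵥ* T) j)
        (by simp only [vecMul, dotProduct]; exact Finset.sum_congr rfl fun i _ => mul_comm _ _)]
      refine Finset.sum_congr rfl fun i _ => ?_
      simp only [hT', Matrix.add_apply, Matrix.smul_apply, vecMulVec_apply, smul_eq_mul]
      ring
    simp only [hN]
    rw [e1, e2]; ring
  have hlog : ∀ x, Real.log (N T' x) ≤ Real.log (N T x) +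
      (((T *ᵥ U x) ⬝ᵥ v) ^ 2 + ε * ∑ j, (v ᵥ* T) j ^ 2) / N T x / q := by
    intro x
    have hp := hNpos T x hT
    have hp' := hNpos T' x hT'0
    have h8 := Real.log_le_sub_one_of_pos (div_pos hp' hp)
    rw [Real.log_div hp'.ne' hp.ne'] at h8
    have e : ∀ a b c : ℝ, 0 < a → (a + b / c) / a = 1 + b / a / c := fun a b c ha => by
      rw [add_div, div_self ha.ne']; ring
    rw [hN' x, e _ _ _ hp] at h8
    rw [hN' x]
    linarith
  have hsum := Finset.sum_le_sum fun x (_ : x ∈ Finset.univ) => hlog x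
  rw [Finset.sum_add_distrib, ← Finset.sum_div] at hsum
  have hle : Φ T' ≤ sSup 𝒮 := le_csSup hbdd ⟨T', hT'0, rfl⟩
  have hΦ' : Φ T' = Fintype.card X * (Real.log 2 + Real.log (T.det ^ 2)) -
      r * ∑ x, Real.log (N T' x) := by
    simp only [hΦ]
    rw [hdet, Real.log_mul (by norm_num) (pow_ne_zero 2 hT)]
  set Sx := ∑ x, (((T *ᵥ U x) ⬝ᵥ v) ^ 2 + ε * ∑ j, (v ᵥ* T) j ^ 2) / N T x with hSx
  have hΦT : Φ T = Fintype.card X * Real.log (T.det ^ 2) - r * ∑ x, Real.log (N T x) := rfl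
  have h9 := mul_le_mul_of_nonneg_left hsum hr'.le
  have h10 : (Fintype.card X : ℝ) / 2 ≤ r * (Sx / q) := by nlinarith
  have h11 : (Fintype.card X : ℝ) / (2 * r) * q = (Fintype.card X : ℝ) / 2 * (q / r) := by
    field_simp
  show _ ≤ Sx
  rw [h11]
  calc (Fintype.card X : ℝ) / 2 * (q / r) ≤ r * (Sx / q) * (q / r) := by gcongr
    _ = Sx := by field_simp

open Matrix in
/-- Forster's inequality: a matrix `G` of small operator norm that agrees in sign with a matrix of
rank `r` cannot have most of its entries large. -/
theorem forster_bound {X Y : Type*} [Fintype X] [Fintype Y] [Nonempty X] [Nonempty Y]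
    {r : ℕ} (hr : 0 < r) (U : X → Fin r → ℝ) (V : Y → Fin r → ℝ)
    (hA : ∀ x y, ∑ i, U x i * V y i ≠ 0) (G : X → Y → ℝ)
    (hG : ∀ x y, 0 ≤ G x y * ∑ i, U x i * V y i) {K : ℝ} (hK0 : 0 ≤ K)
    (hK : ∀ v : Y → ℝ, ∑ x, (∑ y, G x y * v y) ^ 2 ≤
      K ^ 2 * (Fintype.card X * Fintype.card Y) * ∑ y, v y ^ 2)
    (B : Finset (X × Y)) {γ : ℝ} (hγ0 : 0 ≤ γ) (hγ : ∀ x y, (x, y) ∉ B → γ ≤ |G x y|) :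
    γ * (Fintype.card X * Fintype.card Y / (4 * r) - B.card) ≤
      K * (Fintype.card X * Fintype.card Y) := by
  classical
  set a : X → Y → ℝ := fun x y => ∑ i, U x i * V y i with ha
  have hr' : (0 : ℝ) < r := by exact_mod_cast hr
  have hX : (0 : ℝ) < Fintype.card X := by exact_mod_cast Fintype.card_pos
  have hY : (0 : ℝ) < Fintype.card Y := by exact_mod_cast Fintype.card_pos
  obtain ⟨ε, hε, hεa⟩ : ∃ ε : ℝ, 0 < ε ∧ ∀ x y, ε * ∑ j, V y j ^ 2 ≤ a x y ^ 2 := by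
    obtain ⟨p, hp⟩ := Finite.exists_min fun p : X × Y => a p.1 p.2 ^ 2
    have hM : ∀ y, ∑ j, V y j ^ 2 ≤ 1 + ∑ y, ∑ j, V y j ^ 2 := fun y => by
      have := Finset.single_le_sum (f := fun y => ∑ j, V y j ^ 2)
        (fun y _ => Finset.sum_nonneg fun j _ => sq_nonneg (V y j)) (Finset.mem_univ y)
      linarith
    have hM0 : 0 < 1 + ∑ y, ∑ j, V y j ^ 2 := by
      have : 0 ≤ ∑ y, ∑ j, V y j ^ 2 :=
        Finset.sum_nonneg fun y _ => Finset.sum_nonneg fun j _ => sq_nonneg (V y j)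
      linarith
    have hp0 : 0 < a p.1 p.2 ^ 2 := by have := hA p.1 p.2; positivity
    refine ⟨a p.1 p.2 ^ 2 / (1 + ∑ y, ∑ j, V y j ^ 2), div_pos hp0 hM0, fun x y => ?_⟩
    refine le_trans ?_ (hp (x, y))
    rw [div_mul_eq_mul_div, div_le_iff₀ hM0]
    exact mul_le_mul_of_nonneg_left (hM y) hp0.le
  obtain ⟨T, hT, hN, hiso⟩ := exists_nearly_isotropic hr U hε
  set N : X → ℝ := fun x => ∑ i, (T *ᵥ U x) i ^ 2 + ε * ∑ i, ∑ j, T i j ^ 2 with hNdef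
  set w : Y → Fin r → ℝ := fun y => V y ᵥ* T⁻¹ with hw
  have hwT : ∀ y, w y ᵥ* T = V y := fun y => by
    rw [hw, vecMul_vecMul, nonsing_inv_mul _ (isUnit_iff_ne_zero.2 hT), vecMul_one]
  have haw : ∀ x y, (T *ᵥ U x) ⬝ᵥ w y = a x y := fun x y => by
    rw [dotProduct_comm, dotProduct_mulVec, hwT, dotProduct_comm]; rfl
  have hcs : ∀ x y, a x y ^ 2 ≤ (∑ i, (T *ᵥ U x) i ^ 2) * ∑ i, w y i ^ 2 := fun x y => by
    rw [← haw]; exact Finset.sum_mul_sq_le_sq_mul_sq _ _ _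
  obtain ⟨x0⟩ := ‹Nonempty X›
  have hq : ∀ y, 0 < ∑ i, w y i ^ 2 := fun y => by
    have h0 : 0 ≤ ∑ i, w y i ^ 2 := Finset.sum_nonneg fun i _ => sq_nonneg _
    rcases h0.eq_or_lt with h | h
    · have h1 := hcs x0 y
      rw [← h, mul_zero] at h1
      exact absurd (pow_eq_zero_iff two_ne_zero |>.1 (le_antisymm h1 (sq_nonneg _))) (hA x0 y)
    · exact h
  set q : Y → ℝ := fun y => ∑ i, w y i ^ 2 with hqdef
  replace hN : ∀ x, 0 < N x := hN
  replace hq : ∀ y, 0 < q y := hq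
  have hTN : ∀ x, ∑ i, (T *ᵥ U x) i ^ 2 ≤ N x := fun x => by
    have : 0 ≤ ∑ i, ∑ j, T i j ^ 2 :=
      Finset.sum_nonneg fun y _ => Finset.sum_nonneg fun j _ => sq_nonneg _
    simp only [hNdef]
    nlinarith
  set s : X → Y → ℝ := fun x y => a x y / (Real.sqrt (N x) * Real.sqrt (q y)) with hs
  have hs2 : ∀ x y, s x y ^ 2 = a x y ^ 2 / (N x * q y) := fun x y => by
    simp only [hs]
    rw [div_pow, mul_pow, Real.sq_sqrt (hN x).le, Real.sq_sqrt (hq y).le]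
  have hs1 : ∀ x y, |s x y| ≤ 1 := fun x y => by
    rw [← sq_le_one_iff_abs_le_one, hs2, div_le_one (mul_pos (hN x) (hq y))]
    exact (hcs x y).trans (mul_le_mul_of_nonneg_right (hTN x) (hq y).le)
  have hlow : ∀ y, (Fintype.card X : ℝ) / (4 * r) ≤ ∑ x, s x y ^ 2 := fun y => by
    have h1 := hiso (w y)
    simp only [haw, hwT] at h1
    have h2 : ∑ x, (a x y ^ 2 + ε * ∑ j, V y j ^ 2) / N x ≤ ∑ x, 2 * q y * s x y ^ 2 := by
      refine Finset.sum_le_sum fun x _ => ?_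
      rw [hs2, div_le_iff₀ (hN x)]
      have : 2 * q y * (a x y ^ 2 / (N x * q y)) * N x = 2 * a x y ^ 2 := by
        have := (hN x).ne'; have := (hq y).ne'
        field_simp
      rw [this]
      linarith [hεa x y]
    rw [← Finset.mul_sum] at h2
    have h3 := h1.trans h2
    have h4 : (Fintype.card X : ℝ) / (2 * r) * q y =
      2 * q y * ((Fintype.card X : ℝ) / (4 * r)) := by field_simp; ring
    rw [h4] at h3
    exact le_of_mul_le_mul_left h3 (by have := hq y; positivity)
  have hup : ∑ x, ∑ y, G x y * s x y ≤ K * (Fintype.card X * Fintype.card Y) := by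
    refine abs_le_of_sq_le_sq' ?_ (by positivity) |>.2
    have e1 : ∑ x, ∑ y, G x y * s x y = ∑ p : X × Fin r,
        ((T *ᵥ U p.1) p.2 / Real.sqrt (N p.1)) *
          ∑ y, G p.1 y * (w y p.2 / Real.sqrt (q y)) := by
      rw [Fintype.sum_prod_type]
      refine Finset.sum_congr rfl fun x _ => ?_
      simp only [Finset.mul_sum]
      rw [Finset.sum_comm]
      refine Finset.sum_congr rfl fun y _ => ?_
      simp only [hs]
      rw [← haw, dotProduct, Finset.sum_div, Finset.mul_sum]
      refine Finset.sum_congr rfl fun i _ => ?_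
      rw [mul_div_mul_comm]; ring
    rw [e1]
    refine (Finset.sum_mul_sq_le_sq_mul_sq _ _ _).trans ?_
    have e2 : ∑ p : X × Fin r, ((T *ᵥ U p.1) p.2 / Real.sqrt (N p.1)) ^ 2 ≤ Fintype.card X := by
      rw [Fintype.sum_prod_type, ← nsmul_one, ← Finset.card_univ]
      refine Finset.sum_le_card_nsmul _ _ _ fun x _ => ?_
      simp only [div_pow, Real.sq_sqrt (hN x).le]
      rw [← Finset.sum_div, div_le_one (hN x)]
      exact hTN x
    have e3 : ∑ p : X × Fin r, (∑ y, G p.1 y * (w y p.2 / Real.sqrt (q y))) ^ 2 ≤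
        K ^ 2 * (Fintype.card X * Fintype.card Y) * Fintype.card Y := by
      rw [Fintype.sum_prod_type_right]
      calc _ ≤ ∑ i, K ^ 2 * (Fintype.card X * Fintype.card Y) *
              ∑ y, (w y i / Real.sqrt (q y)) ^ 2 := Finset.sum_le_sum fun i _ => hK _
        _ = K ^ 2 * (Fintype.card X * Fintype.card Y) * ∑ y : Y, 1 := by
            rw [← Finset.mul_sum, Finset.sum_comm]
            congr 1
            refine Finset.sum_congr rfl fun y _ => ?_
            simp only [div_pow, Real.sq_sqrt (hq y).le]
            rw [← Finset.sum_div, div_self (hq y).ne']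
        _ = _ := by simp
    calc _ ≤ (Fintype.card X : ℝ) *
          (K ^ 2 * (Fintype.card X * Fintype.card Y) * Fintype.card Y) :=
          mul_le_mul e2 e3 (Finset.sum_nonneg fun _ _ => sq_nonneg _) hX.le
      _ = _ := by ring
  have hterm : ∀ x y, γ * (s x y ^ 2 - if (x, y) ∈ B then 1 else 0) ≤ G x y * s x y := by
    intro x y
    have hGs : G x y * s x y = |G x y| * |s x y| := by
      rw [← abs_mul, abs_of_nonneg]
      simp only [hs]
      rw [← mul_div_assoc]
      exact div_nonneg (hG x y) (by positivity)
    have hsq : s x y ^ 2 ≤ |s x y| := by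
      rw [← sq_abs]; nlinarith [abs_nonneg (s x y), hs1 x y]
    rw [hGs]
    split_ifs with h
    · have h1 : s x y ^ 2 - 1 ≤ 0 := by linarith [hs1 x y]
      have := mul_nonneg (abs_nonneg (G x y)) (abs_nonneg (s x y))
      nlinarith
    · rw [sub_zero]
      exact mul_le_mul (hγ x y h) hsq (sq_nonneg _) (abs_nonneg _)
  have hfin := Finset.sum_le_sum fun p (_ : p ∈ (Finset.univ : Finset (X × Y))) =>
    hterm p.1 p.2
  rw [← Finset.mul_sum, Finset.sum_sub_distrib] at hfin
  simp only [Prod.mk.eta] at hfin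
  rw [Finset.sum_ite_mem, Finset.univ_inter, Finset.sum_const, nsmul_one,
    Fintype.sum_prod_type (f := fun p : X × Y => G p.1 p.2 * s p.1 p.2),
    Fintype.sum_prod_type_right] at hfin
  have hlow' := Finset.sum_le_sum fun y (_ : y ∈ (Finset.univ : Finset Y)) => hlow y
  rw [Finset.sum_const, Finset.card_univ, nsmul_eq_mul] at hlow'
  refine le_trans (mul_le_mul_of_nonneg_left ?_ hγ0) (hfin.trans hup)
  have : (Fintype.card X * Fintype.card Y : ℝ) / (4 * r) =
    Fintype.card Y * (Fintype.card X / (4 * r)) := by ring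
  rw [this]
  simp only at hlow' ⊢
  linarith

theorem prod_add_eq_sum_ite {ι : Type*} [Fintype ι] [DecidableEq ι] (f g : ι → ℝ) :
    ∏ j, (f j + g j) = ∑ S : Finset ι, ∏ j, if j ∈ S then f j else g j := by
  rw [Finset.prod_add, Finset.powerset_univ]
  refine Finset.sum_congr rfl fun S _ => ?_
  rw [← Finset.prod_mul_prod_compl S, ← Finset.compl_eq_univ_sdiff]
  congr 1
  · exact Finset.prod_congr rfl fun j hj => by rw [if_pos hj]
  · exact Finset.prod_congr rfl fun j hj => by rw [if_neg (Finset.mem_compl.1 hj)]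

theorem prod_sum_eq_sum_prod {ι α : Type*} [Fintype ι] [DecidableEq ι] [Fintype α]
    (f : ι → α → ℝ) : ∏ j, ∑ a, f j a = ∑ x : ι → α, ∏ j, f j (x j) := by
  rw [Finset.prod_univ_sum, Fintype.piFinset_univ]

/-- The spectral projection, on functions on `β ^ ι`, onto the functions that depend on exactly the
coordinates in `S`. -/
noncomputable def coordProj {ι β : Type*} [Fintype ι] [DecidableEq ι] [Fintype β] [DecidableEq β]
    (S : Finset ι) (y y' : ι → β) : ℝ :=
  ∏ j, if j ∈ S then (if y j = y' j then 1 else 0) - (Fintype.card β : ℝ)⁻¹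
    else (Fintype.card β : ℝ)⁻¹

theorem gram_of_ne {ι α β : Type*} [Fintype ι] [DecidableEq ι] [Fintype α]
    {h : α → β → ℝ} (hmean : ∀ b, ∑ a, h a b = 0) {S S' : Finset ι} (hS : S ≠ S')
    (y y' : ι → β) :
    ∑ x : ι → α, (∏ j ∈ S, h (x j) (y j)) * ∏ j ∈ S', h (x j) (y' j) = 0 := by
  have e : ∀ x : ι → α, (∏ j ∈ S, h (x j) (y j)) * ∏ j ∈ S', h (x j) (y' j) =
      ∏ j, (if j ∈ S then h (x j) (y j) else 1) * (if j ∈ S' then h (x j) (y' j) else 1) := by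
    intro x
    rw [Finset.prod_mul_distrib]
    congr 1 <;> simp
  simp only [e]
  rw [← prod_sum_eq_sum_prod (fun j a => (if j ∈ S then h a (y j) else 1) *
    (if j ∈ S' then h a (y' j) else 1))]
  have : ∃ j, ¬(j ∈ S ↔ j ∈ S') := by
    by_contra hcon
    push Not at hcon
    exact hS (Finset.ext hcon)
  obtain ⟨j, hj⟩ := this
  refine Finset.prod_eq_zero (Finset.mem_univ j) ?_
  by_cases h1 : j ∈ S <;> by_cases h2 : j ∈ S' <;> simp_all

section
variable {ι β : Type*} [Fintype ι] [DecidableEq ι] [Fintype β] [DecidableEq β]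

theorem sum_coordProj (y y' : ι → β) :
    ∑ S : Finset ι, coordProj S y y' = if y = y' then 1 else 0 := by
  simp only [coordProj]
  rw [← prod_add_eq_sum_ite]
  simp only [sub_add_cancel]
  rw [Finset.prod_ite_zero]
  simp [funext_iff]

theorem coordProj_idem [Nonempty β] (S : Finset ι) (y y' : ι → β) :
    coordProj S y y' = ∑ y'', coordProj S y y'' * coordProj S y' y'' := by
  simp only [coordProj, ← Finset.prod_mul_distrib]
  rw [← prod_sum_eq_sum_prod (fun j b => (if j ∈ S then
    (if y j = b then 1 else 0) - (Fintype.card β : ℝ)⁻¹ else (Fintype.card β : ℝ)⁻¹) *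
    (if j ∈ S then (if y' j = b then 1 else 0) - (Fintype.card β : ℝ)⁻¹
      else (Fintype.card β : ℝ)⁻¹))]
  have hc : (Fintype.card β : ℝ) ≠ 0 := by exact_mod_cast Fintype.card_ne_zero
  refine Finset.prod_congr rfl fun j _ => ?_
  by_cases hj : j ∈ S
  · simp only [hj, if_true, sub_mul, mul_sub, Finset.sum_sub_distrib]
    simp [eq_comm, hc]
  · simp [hj, hc]

theorem sum_coordProj_nonneg [Nonempty β] (S : Finset ι) (v : (ι → β) → ℝ) :
    0 ≤ ∑ y, ∑ y', v y * v y' * coordProj S y y' := by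
  have : ∑ y, ∑ y', v y * v y' * coordProj S y y' =
      ∑ y'', (∑ y, v y * coordProj S y y'') ^ 2 := by
    simp only [sq, Finset.sum_mul_sum]
    conv_rhs => rw [Finset.sum_comm]
    refine Finset.sum_congr rfl fun y _ => ?_
    conv_rhs => rw [Finset.sum_comm]
    refine Finset.sum_congr rfl fun y' _ => ?_
    rw [coordProj_idem, Finset.mul_sum]
    exact Finset.sum_congr rfl fun y'' _ => by ring
  rw [this]
  exact Finset.sum_nonneg fun _ _ => sq_nonneg _

variable {α : Type*} [Fintype α]

theorem gram_self [Nonempty β] {h : α → β → ℝ} {τ : ℝ} (hcov : ∀ b b', ∑ a, h a b * h a b' =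
      Fintype.card α * (τ * ((if b = b' then 1 else 0) - (Fintype.card β : ℝ)⁻¹)))
    (S : Finset ι) (y y' : ι → β) :
    ∑ x : ι → α, (∏ j ∈ S, h (x j) (y j)) * ∏ j ∈ S, h (x j) (y' j) =
      Fintype.card (ι → α) * Fintype.card (ι → β) * (τ / Fintype.card β) ^ S.card *
        coordProj S y y' := by
  have hc : (Fintype.card β : ℝ) ≠ 0 := by exact_mod_cast Fintype.card_ne_zero
  have e : ∀ x : ι → α, (∏ j ∈ S, h (x j) (y j)) * ∏ j ∈ S, h (x j) (y' j) =
      ∏ j, if j ∈ S then h (x j) (y j) * h (x j) (y' j) else 1 := by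
    intro x
    simp [Finset.prod_mul_distrib]
  simp only [e]
  rw [← prod_sum_eq_sum_prod (fun j a => if j ∈ S then h a (y j) * h a (y' j) else 1)]
  have e2 : (τ / Fintype.card β) ^ S.card = ∏ j, if j ∈ S then τ / Fintype.card β else 1 := by
    simp [div_pow]
  rw [e2, coordProj, Fintype.card_fun, Fintype.card_fun]
  push_cast
  rw [← Finset.card_univ (α := ι), ← Finset.prod_const, ← Finset.prod_const,
    ← Finset.prod_mul_distrib, ← Finset.prod_mul_distrib, ← Finset.prod_mul_distrib]
  refine Finset.prod_congr rfl fun j _ => ?_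
  by_cases hj : j ∈ S
  · simp only [hj, if_true, hcov]
    field_simp
  · simp [hj, hc]

theorem sum_block_sq_le [Nonempty β] {h : α → β → ℝ} {τ M : ℝ} (hmean : ∀ b, ∑ a, h a b = 0)
    (hcov : ∀ b b', ∑ a, h a b * h a b' =
      Fintype.card α * (τ * ((if b = b' then 1 else 0) - (Fintype.card β : ℝ)⁻¹)))
    (c : Finset ι → ℝ) (hc : ∀ S, c S ^ 2 * (τ / Fintype.card β) ^ S.card ≤ M)
    (v : (ι → β) → ℝ) :
    ∑ x : ι → α, (∑ y, (∑ S, c S * ∏ j ∈ S, h (x j) (y j)) * v y) ^ 2 ≤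
      M * (Fintype.card (ι → α) * Fintype.card (ι → β)) * ∑ y, v y ^ 2 := by
  set g : Finset ι → (ι → α) → ℝ := fun S x => ∑ y, (∏ j ∈ S, h (x j) (y j)) * v y with hg
  have e1 : ∀ x : ι → α, ∑ y, (∑ S, c S * ∏ j ∈ S, h (x j) (y j)) * v y = ∑ S, c S * g S x := by
    intro x
    simp only [hg, Finset.mul_sum, Finset.sum_mul]
    rw [Finset.sum_comm]
    simp only [mul_assoc]
  have e2 : ∀ S S', ∑ x, g S x * g S' x = ∑ y, ∑ y', v y * v y' *
      ∑ x : ι → α, (∏ j ∈ S, h (x j) (y j)) * ∏ j ∈ S', h (x j) (y' j) := by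
    intro S S'
    simp only [hg, Finset.sum_mul_sum]
    rw [Finset.sum_comm]
    refine Finset.sum_congr rfl fun y _ => ?_
    rw [Finset.sum_comm]
    refine Finset.sum_congr rfl fun y' _ => ?_
    rw [Finset.mul_sum]
    exact Finset.sum_congr rfl fun x _ => by ring
  have e3 : ∀ S S', S ≠ S' → ∑ x, g S x * g S' x = 0 := by
    intro S S' hS
    rw [e2]
    simp [gram_of_ne hmean hS]
  have e4 : ∀ S, ∑ x, g S x * g S x = Fintype.card (ι → α) * Fintype.card (ι → β) *
      (τ / Fintype.card β) ^ S.card * ∑ y, ∑ y', v y * v y' * coordProj S y y' := by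
    intro S
    rw [e2]
    simp only [gram_self hcov, Finset.mul_sum]
    exact Finset.sum_congr rfl fun x _ => Finset.sum_congr rfl fun x _ => by ring
  have e5 : ∑ x : ι → α, (∑ S, c S * g S x) ^ 2 = ∑ S, c S ^ 2 * ∑ x, g S x * g S x := by
    simp only [sq, Finset.sum_mul_sum]
    rw [Finset.sum_comm]
    refine Finset.sum_congr rfl fun S _ => ?_
    rw [Finset.sum_comm, Finset.sum_eq_single S]
    · rw [Finset.mul_sum]; exact Finset.sum_congr rfl fun x _ => by ring
    · intro S' _ hS
      have := e3 S S' hS.symm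
      calc _ = c S * c S' * ∑ x, g S x * g S' x := by
            rw [Finset.mul_sum]; exact Finset.sum_congr rfl fun x _ => by ring
        _ = 0 := by rw [this, mul_zero]
    · simp
  simp only [e1, e5, e4]
  calc _ = ∑ S : Finset ι, (c S ^ 2 * (τ / Fintype.card β) ^ S.card) *
        ((Fintype.card (ι → α) * Fintype.card (ι → β)) *
          ∑ y, ∑ y', v y * v y' * coordProj S y y') :=
        Finset.sum_congr rfl fun x _ => by ring
    _ ≤ ∑ S : Finset ι, M * ((Fintype.card (ι → α) * Fintype.card (ι → β)) *
          ∑ y, ∑ y', v y * v y' * coordProj S y y') :=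
        Finset.sum_le_sum fun S _ => mul_le_mul_of_nonneg_right (hc S)
          (mul_nonneg (by positivity) (sum_coordProj_nonneg S v))
    _ = M * (Fintype.card (ι → α) * Fintype.card (ι → β)) *
          ∑ S : Finset ι, ∑ y, ∑ y', v y * v y' * coordProj S y y' := by
        rw [← Finset.mul_sum, ← Finset.mul_sum]; ring
    _ = _ := by
        congr 1
        rw [Finset.sum_comm]
        refine Finset.sum_congr rfl fun y _ => ?_
        rw [Finset.sum_comm]
        simp only [← Finset.mul_sum, sum_coordProj]
        simp [sq]

end

/-- The indicator that the permutation `π` sends `b` below `W`. -/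
noncomputable def permInd (ℓ W : ℕ) (π : Equiv.Perm (Fin ℓ)) (b : Fin ℓ) : ℝ :=
  if (π b : ℕ) < W then 1 else 0

theorem sum_permInd_right {ℓ W : ℕ} (hW : W ≤ ℓ) (π : Equiv.Perm (Fin ℓ)) :
    ∑ b, permInd ℓ W π b = W := by
  simp only [permInd]
  rw [Equiv.sum_comp π (fun b : Fin ℓ => if (b : ℕ) < W then (1 : ℝ) else 0),
    Fin.sum_univ_eq_sum_range (fun b => if b < W then (1 : ℝ) else 0), ← Finset.sum_filter]
  simp only [Finset.sum_const, nsmul_one]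
  have : {i ∈ Finset.range ℓ | i < W} = Finset.range W := by
    ext i
    simp only [Finset.mem_filter, Finset.mem_range]
    omega
  rw [this, Finset.card_range]

theorem permInd_mul_swap {ℓ W : ℕ} (π : Equiv.Perm (Fin ℓ)) (b b' c : Fin ℓ) :
    permInd ℓ W (π * Equiv.swap b b') c = permInd ℓ W π (Equiv.swap b b' c) := by
  rfl

theorem sum_permInd_left {ℓ W : ℕ} (hW : W ≤ ℓ) (b : Fin ℓ) :
    ∑ π, permInd ℓ W π b = Fintype.card (Equiv.Perm (Fin ℓ)) * ((W : ℝ) / ℓ) := by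
  have hℓ : (ℓ : ℝ) ≠ 0 := by
    have := b.pos
    exact_mod_cast this.ne'
  have h1 : ∀ b', ∑ π, permInd ℓ W π b' = ∑ π, permInd ℓ W π b := by
    intro b'
    rw [← Equiv.sum_comp (Equiv.mulRight (Equiv.swap b b'))]
    simp [permInd_mul_swap]
  have h2 : ∑ b', ∑ π, permInd ℓ W π b' = ∑ π : Equiv.Perm (Fin ℓ), (W : ℝ) := by
    rw [Finset.sum_comm]
    exact Finset.sum_congr rfl fun π _ => sum_permInd_right hW π
  simp only [h1, Finset.sum_const, Finset.card_univ, nsmul_eq_mul, Fintype.card_fin] at h2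
  rw [← mul_div_assoc, eq_div_iff hℓ, ← h2, mul_comm]

theorem sum_permInd_sub_left {ℓ W : ℕ} (hW : W ≤ ℓ) (b : Fin ℓ) :
    ∑ π, (permInd ℓ W π b - (W : ℝ) / ℓ) = 0 := by
  rw [Finset.sum_sub_distrib, sum_permInd_left hW]
  simp

theorem sum_permInd_cov {ℓ W : ℕ} (hW : W ≤ ℓ) (hℓ : 2 ≤ ℓ) (b b' : Fin ℓ) :
    ∑ π, (permInd ℓ W π b - (W : ℝ) / ℓ) * (permInd ℓ W π b' - (W : ℝ) / ℓ) =
      Fintype.card (Equiv.Perm (Fin ℓ)) * (((W : ℝ) / ℓ * (1 - (W : ℝ) / ℓ) * (ℓ / (ℓ - 1))) *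
        ((if b = b' then 1 else 0) - (Fintype.card (Fin ℓ) : ℝ)⁻¹)) := by
  have hℓ0 : (ℓ : ℝ) ≠ 0 := by positivity
  have hℓ1 : (ℓ : ℝ) - 1 ≠ 0 := by
    have : (2 : ℝ) ≤ ℓ := by exact_mod_cast hℓ
    linarith
  set q : ℝ := (W : ℝ) / ℓ with hq
  set g : Fin ℓ → Fin ℓ → ℝ := fun b b' =>
    ∑ π, (permInd ℓ W π b - q) * (permInd ℓ W π b' - q) with hg
  have hdiag : g b b = Fintype.card (Equiv.Perm (Fin ℓ)) * (q * (1 - q)) := by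
    have : ∀ π, (permInd ℓ W π b - q) * (permInd ℓ W π b - q) =
        (1 - 2 * q) * (permInd ℓ W π b - q) + q * (1 - q) := by
      intro π
      unfold permInd
      split_ifs <;> ring
    simp only [hg, this]
    rw [Finset.sum_add_distrib, ← Finset.mul_sum, sum_permInd_sub_left hW]
    simp
  by_cases hb : b = b'
  · subst hb
    change g b b = _
    rw [hdiag]
    simp only [if_true, Fintype.card_fin]
    field_simp
  · change g b b' = _
    have hsym : ∀ c ∈ Finset.univ.erase b, g b c = g b b' := by
      intro c hc
      have hcb := Finset.ne_of_mem_erase hc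
      simp only [hg]
      rw [← Equiv.sum_comp (Equiv.mulRight (Equiv.swap b' c))]
      simp [permInd_mul_swap, Equiv.swap_apply_of_ne_of_ne hb hcb.symm]
    have hzero : ∑ c, g b c = 0 := by
      simp only [hg]
      rw [Finset.sum_comm]
      refine Finset.sum_eq_zero fun π _ => ?_
      rw [← Finset.mul_sum, Finset.sum_sub_distrib, sum_permInd_right hW]
      simp [hq, hℓ0, mul_div_cancel₀]
    rw [← Finset.add_sum_erase _ _ (Finset.mem_univ b), Finset.sum_congr rfl hsym, hdiag,
      Finset.sum_const, Finset.card_erase_of_mem (Finset.mem_univ b), Finset.card_univ,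
      Fintype.card_fin, nsmul_eq_mul, Nat.cast_sub (by omega), Nat.cast_one] at hzero
    simp only [hb, if_false, Fintype.card_fin]
    have : g b b' = -(Fintype.card (Equiv.Perm (Fin ℓ)) * (q * (1 - q))) / (ℓ - 1) := by
      rw [eq_div_iff hℓ1]; linarith
    rw [this]
    field_simp
    ring

theorem sum_layer_superset {m : ℕ} (Ψ : ℕ → ℝ) (T : Finset (Fin m)) :
    ∑ A : Finset (Fin m), Ψ A.card / m.choose A.card * (if T ⊆ A then 1 else 0) =
      (∑ i ∈ Finset.range (m + 1), Ψ i * i.choose T.card) / m.choose T.card := by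
  have hT : T.card ≤ m := by simpa using Finset.card_le_univ T
  set f : ℕ → ℝ := fun i => Ψ i / m.choose i with hf
  have h1 : ∑ A : Finset (Fin m), f A.card * (if T ⊆ A then 1 else 0) =
      ∑ B ∈ (Finset.univ \ T).powerset, f (T.card + B.card) := by
    simp only [mul_ite, mul_one, mul_zero]
    rw [← Finset.sum_filter]
    have : Finset.univ.filter (fun A : Finset (Fin m) => T ⊆ A) = Finset.Icc T Finset.univ := by
      ext A; simp
    rw [this, Finset.Icc_eq_image_powerset (Finset.subset_univ T), Finset.sum_image]
    · refine Finset.sum_congr rfl fun B hB => ?_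
      rw [Finset.card_union_of_disjoint]
      exact Finset.disjoint_of_subset_right (Finset.mem_powerset.1 hB) Finset.disjoint_sdiff
    · intro B hB B' hB' h
      have e : ∀ C ∈ (Finset.univ \ T).powerset, (T ∪ C) \ T = C := fun C hC => by
        rw [Finset.union_sdiff_left, Finset.sdiff_eq_self_iff_disjoint]
        exact Finset.disjoint_of_subset_left (Finset.mem_powerset.1 hC) Finset.sdiff_disjoint
      rw [← e B hB, ← e B' hB']
      exact congrArg (· \ T) h
  rw [h1, Finset.sum_powerset_apply_card (fun k => f (T.card + k))]
  have hc : (Finset.univ \ T).card = m - T.card := by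
    rw [Finset.card_sdiff_of_subset (Finset.subset_univ T)]; simp
  rw [hc, Finset.sum_div]
  have h2 : ∑ i ∈ Finset.range (m + 1), Ψ i * i.choose T.card / m.choose T.card =
      ∑ i ∈ Finset.Ico T.card (m + 1), Ψ i * i.choose T.card / m.choose T.card := by
    symm
    refine Finset.sum_subset (fun i hi => ?_) fun i _ hi => ?_
    · simp only [Finset.mem_Ico, Finset.mem_range] at hi ⊢; omega
    · simp only [Finset.mem_Ico, Finset.mem_range] at *
      rw [Nat.choose_eq_zero_of_lt (by omega)]; simp
  rw [h2, Finset.sum_Ico_eq_sum_range, Nat.sub_add_comm hT]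
  refine Finset.sum_congr rfl fun k hk => ?_
  simp only [Finset.mem_range] at hk
  have hk' : T.card + k ≤ m := by omega
  have h3 := Nat.choose_mul (n := m) (Nat.le_add_right T.card k)
  rw [Nat.add_sub_cancel_left] at h3
  have h3' : (m.choose (T.card + k) : ℝ) * (T.card + k).choose T.card =
    m.choose T.card * (m - T.card).choose k := by exact_mod_cast h3
  have c1 : (m.choose (T.card + k) : ℝ) ≠ 0 := by exact_mod_cast (Nat.choose_pos hk').ne'
  have c2 : (m.choose T.card : ℝ) ≠ 0 := by exact_mod_cast (Nat.choose_pos hT).ne'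
  simp only [hf, nsmul_eq_mul]
  rw [← mul_div_assoc, div_eq_div_iff c1 c2]
  linear_combination (-Ψ (T.card + k)) * h3'

theorem sum_layer_prod_eq_zero {m d : ℕ} (Ψ : ℕ → ℝ)
    (hΨ : ∀ τ < d, ∑ i ∈ Finset.range (m + 1), Ψ i * i.choose τ = 0) (q : ℝ)
    (S : Finset (Fin m)) (hS : S.card < d) :
    ∑ A : Finset (Fin m), Ψ A.card / m.choose A.card *
      ∏ j ∈ S, ((if j ∈ A then 1 else 0) - q) = 0 := by
  have h1 : ∀ A : Finset (Fin m), ∏ j ∈ S, ((if j ∈ A then (1 : ℝ) else 0) - q) =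
      ∑ T ∈ S.powerset, (if T ⊆ A then 1 else 0) * ∏ _j ∈ S \ T, (-q) := by
    intro A
    simp only [sub_eq_add_neg]
    rw [Finset.prod_add]
    refine Finset.sum_congr rfl fun T _ => ?_
    congr 1
    rw [Finset.prod_ite_zero]
    simp [Finset.subset_iff]
  simp only [h1, Finset.mul_sum]
  rw [Finset.sum_comm]
  refine Finset.sum_eq_zero fun T hT => ?_
  simp only [← mul_assoc]
  rw [← Finset.sum_mul, sum_layer_superset,
    hΨ _ ((Finset.card_le_card (Finset.mem_powerset.1 hT)).trans_lt hS)]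
  simp

theorem sum_layer_abs {m : ℕ} (Ψ : ℕ → ℝ) :
    ∑ A : Finset (Fin m), |Ψ A.card / m.choose A.card| = ∑ i ∈ Finset.range (m + 1), |Ψ i| := by
  have := Finset.sum_powerset_apply_card (fun k => |Ψ k / m.choose k|)
    (x := (Finset.univ : Finset (Fin m)))
  simp only [Finset.powerset_univ, Finset.card_univ, Fintype.card_fin] at this
  rw [this]
  refine Finset.sum_congr rfl fun k hk => ?_
  have c1 : (0 : ℝ) < m.choose k := by
    exact_mod_cast Nat.choose_pos (by simp only [Finset.mem_range] at hk; omega)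
  rw [abs_div, abs_of_pos c1, nsmul_eq_mul, mul_div_cancel₀ _ (ne_of_gt c1)]

/-- The `q`-biased Fourier coefficient of `φ / p`, where `p` is the `q`-biased measure. -/
noncomputable def biasedCoeff {m : ℕ} (φ : Finset (Fin m) → ℝ) (q : ℝ) (S : Finset (Fin m)) : ℝ :=
  ∑ A, φ A * ∏ j ∈ S, (((if j ∈ A then 1 else 0) - q) / (q * (1 - q)))

theorem sum_biasedCoeff {m : ℕ} (φ : Finset (Fin m) → ℝ) {q : ℝ} (hq0 : 0 < q) (hq1 : q < 1)
    (z : Finset (Fin m)) :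
    ∑ S, biasedCoeff φ q S * ∏ j ∈ S, ((if j ∈ z then 1 else 0) - q) =
      φ z / (q ^ z.card * (1 - q) ^ (m - z.card)) := by
  have hq2 : 1 - q ≠ 0 := by linarith
  have h1 : ∀ A : Finset (Fin m), ∑ S : Finset (Fin m),
      (∏ j ∈ S, (((if j ∈ A then 1 else 0) - q) / (q * (1 - q)))) *
        ∏ j ∈ S, ((if j ∈ z then 1 else 0) - q) =
      if A = z then 1 / (q ^ z.card * (1 - q) ^ (m - z.card)) else 0 := by
    intro A
    simp only [← Finset.prod_mul_distrib]
    rw [← Finset.powerset_univ, ← Finset.prod_one_add]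
    split_ifs with h
    · subst h
      have : ∀ j, 1 + ((if j ∈ A then 1 else 0) - q) / (q * (1 - q)) *
          ((if j ∈ A then 1 else 0) - q) = if j ∈ A then 1 / q else 1 / (1 - q) := by
        intro j
        split_ifs <;> field_simp <;> ring
      simp only [this]
      rw [Finset.prod_ite, Finset.prod_const, Finset.prod_const]
      have e1 : Finset.univ.filter (fun j => j ∈ A) = A := by ext; simp
      have e2 : (Finset.univ.filter (fun j => j ∉ A)).card = m - A.card := by
        have : Finset.univ.filter (fun j => j ∉ A) = Aᶜ := by ext; simp
        rw [this, Finset.card_compl, Fintype.card_fin]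
      rw [e1, e2, one_div, one_div, one_div, inv_pow, inv_pow, mul_inv]
    · have : ∃ j, ¬(j ∈ A ↔ j ∈ z) := by
        by_contra hcon
        push Not at hcon
        exact h (Finset.ext hcon)
      obtain ⟨j, hj⟩ := this
      refine Finset.prod_eq_zero (Finset.mem_univ j) ?_
      by_cases h1 : j ∈ A <;> by_cases h2 : j ∈ z <;> simp_all <;> field_simp <;> ring
  simp only [biasedCoeff, Finset.sum_mul]
  rw [Finset.sum_comm]
  simp only [mul_assoc, ← Finset.mul_sum, h1]
  simp [div_eq_mul_inv]

theorem biasedCoeff_layer_eq_zero {m d : ℕ} (Ψ : ℕ → ℝ)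
    (hΨ : ∀ τ < d, ∑ i ∈ Finset.range (m + 1), Ψ i * i.choose τ = 0) (q : ℝ)
    (S : Finset (Fin m)) (hS : S.card < d) :
    biasedCoeff (fun A => Ψ A.card / m.choose A.card) q S = 0 := by
  simp only [biasedCoeff, Finset.prod_div_distrib, ← mul_div_assoc]
  rw [← Finset.sum_div, sum_layer_prod_eq_zero Ψ hΨ q S hS, zero_div]

theorem abs_biasedCoeff_le {m : ℕ} (φ : Finset (Fin m) → ℝ) {q : ℝ} (hq0 : 0 < q) (hq1 : q < 1)
    (hφ : ∑ A, |φ A| ≤ 1) (S : Finset (Fin m)) :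
    |biasedCoeff φ q S| ≤ (1 / (q * (1 - q))) ^ S.card := by
  have hq2 : 0 < q * (1 - q) := mul_pos hq0 (by linarith)
  calc |biasedCoeff φ q S| ≤
        ∑ A, |φ A * ∏ j ∈ S, (((if j ∈ A then 1 else 0) - q) / (q * (1 - q)))| :=
        Finset.abs_sum_le_sum_abs _ _
    _ ≤ ∑ A, |φ A| * (1 / (q * (1 - q))) ^ S.card := by
        refine Finset.sum_le_sum fun A _ => ?_
        rw [abs_mul, Finset.abs_prod]
        refine mul_le_mul_of_nonneg_left ?_ (abs_nonneg _)
        rw [← Finset.prod_const]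
        refine Finset.prod_le_prod (fun j _ => abs_nonneg _) fun j _ => ?_
        rw [abs_div, abs_of_pos hq2]
        refine div_le_div_of_nonneg_right ?_ hq2.le
        split_ifs <;> rw [abs_le] <;> constructor <;> linarith
    _ ≤ _ := by
        rw [← Finset.sum_mul]
        exact mul_le_of_le_one_left (by positivity) hφ

/-- The set of blocks in which the permutation sends the chosen point below `W`. -/
def hitSet {m ℓ : ℕ} (W : ℕ) (x : Fin m → Equiv.Perm (Fin ℓ)) (y : Fin m → Fin ℓ) :
    Finset (Fin m) := Finset.univ.filter fun j => (x j (y j) : ℕ) < W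

theorem permInd_eq_hitSet {m ℓ : ℕ} (W : ℕ) (x : Fin m → Equiv.Perm (Fin ℓ)) (y : Fin m → Fin ℓ)
    (j : Fin m) : permInd ℓ W (x j) (y j) = if j ∈ hitSet W x y then 1 else 0 := by
  simp [permInd, hitSet]

theorem sum_exp_hitSet_le {m ℓ W : ℕ} (hW : W ≤ ℓ) {s : ℝ} (hs : |s| ≤ 1)
    (y : Fin m → Fin ℓ) :
    ∑ x : Fin m → Equiv.Perm (Fin ℓ), Real.exp (s * (hitSet W x y).card) ≤
      Fintype.card (Fin m → Equiv.Perm (Fin ℓ)) *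
        Real.exp (m * ((W : ℝ) / ℓ) * (s + s ^ 2)) := by
  have h1 : ∀ x : Fin m → Equiv.Perm (Fin ℓ), Real.exp (s * (hitSet W x y).card) =
      ∏ j, (1 + (Real.exp s - 1) * permInd ℓ W (x j) (y j)) := by
    intro x
    have : ∀ j, 1 + (Real.exp s - 1) * permInd ℓ W (x j) (y j) =
        if j ∈ hitSet W x y then Real.exp s else 1 := by
      intro j
      rw [permInd_eq_hitSet]
      split_ifs <;> ring
    simp only [this]
    rw [mul_comm, Real.exp_nat_mul]
    simp
  simp only [h1]
  rw [← prod_sum_eq_sum_prod (fun j π => 1 + (Real.exp s - 1) * permInd ℓ W π (y j))]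
  have h2 : ∀ j, ∑ π, (1 + (Real.exp s - 1) * permInd ℓ W π (y j)) =
      Fintype.card (Equiv.Perm (Fin ℓ)) * (1 + (Real.exp s - 1) * ((W : ℝ) / ℓ)) := by
    intro j
    rw [Finset.sum_add_distrib, ← Finset.mul_sum, sum_permInd_left hW]
    simp
    ring
  simp only [h2]
  rw [Finset.prod_const, Finset.card_univ, Fintype.card_fin, mul_pow, Fintype.card_fun,
    Fintype.card_fin]
  push_cast
  refine mul_le_mul_of_nonneg_left ?_ (by positivity)
  have hq0 : 0 ≤ (W : ℝ) / ℓ := by positivity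
  have hq1 : (W : ℝ) / ℓ ≤ 1 := div_le_one_of_le₀ (by exact_mod_cast hW) (by positivity)
  have h3 : (Real.exp s - 1) * ((W : ℝ) / ℓ) ≤ (s + s ^ 2) * ((W : ℝ) / ℓ) := by
    have := (abs_le.1 (Real.abs_exp_sub_one_sub_id_le hs)).2
    exact mul_le_mul_of_nonneg_right (by linarith) hq0
  have h4 : 0 ≤ 1 + (Real.exp s - 1) * ((W : ℝ) / ℓ) := by
    nlinarith [Real.exp_pos s]
  calc (1 + (Real.exp s - 1) * ((W : ℝ) / ℓ)) ^ m
      ≤ (Real.exp ((s + s ^ 2) * ((W : ℝ) / ℓ))) ^ m := by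
        refine pow_le_pow_left₀ h4 ?_ m
        have := Real.add_one_le_exp ((s + s ^ 2) * ((W : ℝ) / ℓ))
        linarith
    _ = _ := by rw [← Real.exp_nat_mul]; congr 1; ring

theorem card_hitSet_tail_le {m ℓ W : ℕ} (hW : W ≤ ℓ) {lam ρ : ℝ} (hlam : lam = m * ((W : ℝ) / ℓ))
    (hlam0 : 0 < lam) (hρ0 : 0 ≤ ρ) (hρ : ρ ≤ 2 * lam) :
    ((Finset.univ.filter fun p : (Fin m → Equiv.Perm (Fin ℓ)) × (Fin m → Fin ℓ) =>
      ρ < |((hitSet W p.1 p.2).card : ℝ) - lam|).card : ℝ) ≤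
      2 * Real.exp (-(ρ ^ 2 / (4 * lam))) *
        (Fintype.card (Fin m → Equiv.Perm (Fin ℓ)) * Fintype.card (Fin m → Fin ℓ)) := by
  set s : ℝ := ρ / (2 * lam) with hs
  have hs0 : 0 ≤ s := by positivity
  have hs1 : s ≤ 1 := div_le_one_of_le₀ hρ (by positivity)
  have key : ∀ s' : ℝ, |s'| ≤ 1 →
      ∑ p : (Fin m → Equiv.Perm (Fin ℓ)) × (Fin m → Fin ℓ),
        Real.exp (s' * (hitSet W p.1 p.2).card) ≤
      Fintype.card (Fin m → Equiv.Perm (Fin ℓ)) * Fintype.card (Fin m → Fin ℓ) *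
        Real.exp (lam * (s' + s' ^ 2)) := by
    intro s' hs'
    rw [Fintype.sum_prod_type_right]
    calc _ ≤ ∑ y : Fin m → Fin ℓ, Fintype.card (Fin m → Equiv.Perm (Fin ℓ)) *
          Real.exp (lam * (s' + s' ^ 2)) := Finset.sum_le_sum fun y _ => by
            rw [hlam]; exact sum_exp_hitSet_le hW hs' y
      _ = _ := by rw [Finset.sum_const, Finset.card_univ, nsmul_eq_mul]; ring
  have k1 := key s (by rwa [abs_of_nonneg hs0])
  have k2 := key (-s) (by rwa [abs_neg, abs_of_nonneg hs0])
  have e1 : lam * (s + s ^ 2) = s * (lam + ρ) - ρ ^ 2 / (4 * lam) := by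
    rw [hs]; field_simp; ring
  have e2 : lam * (-s + (-s) ^ 2) = -s * (lam - ρ) - ρ ^ 2 / (4 * lam) := by
    rw [hs]; field_simp; ring
  have hpt : ∀ p : (Fin m → Equiv.Perm (Fin ℓ)) × (Fin m → Fin ℓ),
      (if ρ < |((hitSet W p.1 p.2).card : ℝ) - lam| then (1 : ℝ) else 0) ≤
        Real.exp (-(s * (lam + ρ))) * Real.exp (s * (hitSet W p.1 p.2).card) +
        Real.exp (-(-s * (lam - ρ))) * Real.exp (-s * (hitSet W p.1 p.2).card) := by
    intro p
    rw [← Real.exp_add, ← Real.exp_add]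
    split_ifs with h
    · rcases lt_abs.1 h with h | h
      · have : 0 ≤ -(s * (lam + ρ)) + s * (hitSet W p.1 p.2).card := by nlinarith
        exact (Real.one_le_exp this).trans (le_add_of_nonneg_right (Real.exp_pos _).le)
      · have : 0 ≤ -(-s * (lam - ρ)) + -s * (hitSet W p.1 p.2).card := by nlinarith
        exact (Real.one_le_exp this).trans (le_add_of_nonneg_left (Real.exp_pos _).le)
    · positivity
  have hsum := Finset.sum_le_sum fun p (_ : p ∈ Finset.univ) => hpt p
  rw [Finset.sum_add_distrib, ← Finset.mul_sum, ← Finset.mul_sum, ← Finset.sum_filter,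
    Finset.sum_const, nsmul_one] at hsum
  refine hsum.trans ?_
  have m1 := mul_le_mul_of_nonneg_left k1 (Real.exp_pos (-(s * (lam + ρ)))).le
  have m2 := mul_le_mul_of_nonneg_left k2 (Real.exp_pos (-(-s * (lam - ρ)))).le
  have e3 : Real.exp (-(s * (lam + ρ))) * Real.exp (lam * (s + s ^ 2)) =
      Real.exp (-(ρ ^ 2 / (4 * lam))) := by
    rw [← Real.exp_add, e1]; congr 1; ring
  have e4 : Real.exp (-(-s * (lam - ρ))) * Real.exp (lam * (-s + (-s) ^ 2)) =
      Real.exp (-(ρ ^ 2 / (4 * lam))) := by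
    rw [← Real.exp_add, e2]; congr 1; ring
  rw [mul_left_comm, e3] at m1
  rw [mul_left_comm, e4] at m2
  linarith

/-- A rank bound for the block matrix `Ψ(|z(x, y)|)`. -/
theorem block_rank_bound {m ℓ W d r : ℕ} (hr : 0 < r) (hℓ : 2 * W ≤ ℓ) (hW : 1 ≤ W)
    (U : (Fin m → Equiv.Perm (Fin ℓ)) → Fin r → ℝ) (V : (Fin m → Fin ℓ) → Fin r → ℝ)
    (hA : ∀ x y, ∑ i, U x i * V y i ≠ 0) {Ψ : ℕ → ℝ}
    (horth : ∀ τ < d, ∑ i ∈ Finset.range (m + 1), Ψ i * i.choose τ = 0)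
    (hsum : ∑ i ∈ Finset.range (m + 1), |Ψ i| ≤ 1)
    (hsign : ∀ x y, 0 ≤ Ψ (hitSet W x y).card * ∑ i, U x i * V y i)
    {lam ρ γ θ : ℝ} (hlam : lam = m * ((W : ℝ) / ℓ)) (hlam0 : 0 < lam) (hρ0 : 0 ≤ ρ)
    (hρ : ρ ≤ 2 * lam) (hγ0 : 0 ≤ γ)
    (hγ : ∀ i ≤ m, |(i : ℝ) - lam| ≤ ρ →
      γ * (m.choose i * (((W : ℝ) / ℓ) ^ i * (1 - (W : ℝ) / ℓ) ^ (m - i))) ≤ |Ψ i|)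
    (hθ0 : 0 ≤ θ) (hθ1 : θ ≤ 1) (hθ : 4 / (W : ℝ) ≤ θ ^ 2) :
    γ * (1 / (4 * r) - 2 * Real.exp (-(ρ ^ 2 / (4 * lam)))) ≤ θ ^ d := by
  have hW' : (1 : ℝ) ≤ W := by exact_mod_cast hW
  have hℓ' : 2 * (W : ℝ) ≤ ℓ := by exact_mod_cast hℓ
  have hℓ0 : (0 : ℝ) < ℓ := by linarith
  have hℓ1 : (0 : ℝ) < ℓ - 1 := by linarith
  have : Nonempty (Fin ℓ) := ⟨⟨0, by omega⟩⟩
  set q : ℝ := (W : ℝ) / ℓ with hq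
  have hq0 : 0 < q := by positivity
  have hq1 : q ≤ 1 / 2 := by rw [hq, div_le_iff₀ hℓ0]; linarith
  have hσ : 0 < q * (1 - q) := mul_pos hq0 (by linarith)
  set φ : Finset (Fin m) → ℝ := fun A => Ψ A.card / m.choose A.card with hφ
  set G : (Fin m → Equiv.Perm (Fin ℓ)) → (Fin m → Fin ℓ) → ℝ := fun x y =>
    ∑ S, biasedCoeff φ q S * ∏ j ∈ S, (permInd ℓ W (x j) (y j) - q) with hG
  set p : Finset (Fin m) → ℝ := fun z => q ^ z.card * (1 - q) ^ (m - z.card) with hp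
  have hp0 : ∀ z, 0 < p z := fun z =>
    mul_pos (pow_pos hq0 _) (pow_pos (by linarith) _)
  have hC0 : ∀ z : Finset (Fin m), (0 : ℝ) < m.choose z.card := fun z => by
    have : z.card ≤ m := by simpa using Finset.card_le_univ z
    exact_mod_cast Nat.choose_pos this
  have hGz : ∀ x y, G x y = Ψ (hitSet W x y).card / (m.choose (hitSet W x y).card *
      p (hitSet W x y)) := by
    intro x y
    simp only [hG, permInd_eq_hitSet]
    rw [sum_biasedCoeff φ hq0 (by linarith), hφ, div_div]
  have hθS : ∀ S, biasedCoeff φ q S ^ 2 *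
      ((q * (1 - q) * (ℓ / (ℓ - 1))) / (Fintype.card (Fin ℓ) : ℝ)) ^ S.card ≤ (θ ^ d) ^ 2 := by
    intro S
    rcases lt_or_ge S.card d with hS | hS
    · rw [biasedCoeff_layer_eq_zero Ψ horth q S hS]
      simp only [ne_eq, OfNat.ofNat_ne_zero, not_false_eq_true, zero_pow, zero_mul]
      positivity
    · have h1 := abs_biasedCoeff_le φ hq0 (by linarith) (by rwa [sum_layer_abs]) S
      have h2 : biasedCoeff φ q S ^ 2 ≤ ((1 / (q * (1 - q))) ^ S.card) ^ 2 := by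
        rw [← sq_abs]; exact pow_le_pow_left₀ (abs_nonneg _) h1 2
      have h3 : 1 / (q * (1 - q) * (ℓ - 1)) ≤ θ ^ 2 := by
        refine le_trans ?_ hθ
        rw [div_le_div_iff₀ (mul_pos hσ hℓ1) (by linarith)]
        have e : q * (1 - q) * (ℓ - 1) = W * ((1 - q) * ((ℓ - 1) / ℓ)) := by
          rw [hq]; ring
        have h5 : (1 : ℝ) / 2 ≤ (ℓ - 1) / ℓ := by rw [div_le_div_iff₀ (by norm_num) hℓ0]; linarith
        have h6 : (1 : ℝ) / 4 ≤ (1 - q) * ((ℓ - 1) / ℓ) := by nlinarith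
        rw [e]; nlinarith
      calc _ ≤ ((1 / (q * (1 - q))) ^ S.card) ^ 2 *
          ((q * (1 - q) * (ℓ / (ℓ - 1))) / (Fintype.card (Fin ℓ) : ℝ)) ^ S.card := by gcongr
        _ = (1 / (q * (1 - q) * (ℓ - 1))) ^ S.card := by
          rw [← pow_mul, mul_comm S.card, pow_mul, ← mul_pow, Fintype.card_fin]
          congr 1
          field_simp
        _ ≤ (θ ^ 2) ^ S.card := by
          refine pow_le_pow_left₀ ?_ h3 _
          exact div_nonneg zero_le_one (mul_pos hσ hℓ1).le
        _ ≤ (θ ^ 2) ^ d := pow_le_pow_of_le_one (by positivity) (pow_le_one₀ hθ0 hθ1) hS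
        _ = _ := by rw [← pow_mul, ← pow_mul, mul_comm]
  have hnorm := sum_block_sq_le (sum_permInd_sub_left (by omega))
    (sum_permInd_cov (by omega) (by omega)) (biasedCoeff φ q) hθS
  have hsgn : ∀ x y, 0 ≤ G x y * ∑ i, U x i * V y i := by
    intro x y
    rw [hGz, div_mul_eq_mul_div]
    exact div_nonneg (hsign x y) (mul_pos (hC0 _) (hp0 _)).le
  set B := Finset.univ.filter fun p : (Fin m → Equiv.Perm (Fin ℓ)) × (Fin m → Fin ℓ) =>
      ρ < |((hitSet W p.1 p.2).card : ℝ) - lam| with hB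
  have hlow : ∀ x y, (x, y) ∉ B → γ ≤ |G x y| := by
    intro x y hxy
    simp only [hB, Finset.mem_filter, Finset.mem_univ, true_and, not_lt] at hxy
    have h1 := hγ _ (by simpa using Finset.card_le_univ (hitSet W x y)) hxy
    have h2 := mul_pos (hC0 (hitSet W x y)) (hp0 (hitSet W x y))
    rw [hGz, abs_div, abs_of_pos h2, le_div_iff₀ h2]
    exact h1
  have hfor := forster_bound hr U V hA G hsgn (pow_nonneg hθ0 d) hnorm B hγ0 hlow
  have htail := card_hitSet_tail_le (m := m) (W := W) (ℓ := ℓ) (by omega) hlam hlam0 hρ0 hρ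
  set M : ℝ := (Fintype.card (Fin m → Equiv.Perm (Fin ℓ)) * Fintype.card (Fin m → Fin ℓ) : ℝ)
    with hM
  have hM0 : 0 < M := mul_pos (by exact_mod_cast Fintype.card_pos)
    (by exact_mod_cast Fintype.card_pos)
  have h1 : γ * (M / (4 * r) - 2 * Real.exp (-(ρ ^ 2 / (4 * lam))) * M) ≤ θ ^ d * M :=
    le_trans (mul_le_mul_of_nonneg_left (by linarith) hγ0) hfor
  refine le_of_mul_le_mul_right (le_trans (le_of_eq ?_) h1) hM0
  ring

theorem exists_block_embedding {m ℓ n t : ℕ} (W : ℕ) (h : t + m * ℓ ≤ n) :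
    ∃ (X : (Fin m → Equiv.Perm (Fin ℓ)) → Fin n → Bool) (Y : (Fin m → Fin ℓ) → Fin n → Bool),
      ∀ x y, hamW (band (X x) (Y y)) = t + (hitSet W x y).card := by
  classical
  obtain ⟨e⟩ : Nonempty (Fin t ⊕ (Fin m × Fin ℓ) ↪ Fin n) :=
    Function.Embedding.nonempty_of_card_le (by simpa using h)
  refine ⟨fun x i => decide (∃ a, e a = i ∧ Sum.elim (fun _ => True)
      (fun p => (x p.1 p.2 : ℕ) < W) a),
    fun y i => decide (∃ a, e a = i ∧ Sum.elim (fun _ => True) (fun p => p.2 = y p.1) a),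
    fun x y => ?_⟩
  have h1 : Finset.univ.filter (fun i => band
      (fun i => decide (∃ a, e a = i ∧ Sum.elim (fun _ => True)
        (fun p => (x p.1 p.2 : ℕ) < W) a))
      (fun i => decide (∃ a, e a = i ∧ Sum.elim (fun _ => True) (fun p => p.2 = y p.1) a)) i) =
      ((Finset.univ : Finset (Fin t)).disjSum
        ((hitSet W x y).image fun j => (j, y j))).map e := by
    ext i
    simp only [band, Bool.and_eq_true, decide_eq_true_eq, Finset.mem_filter, Finset.mem_univ,
      true_and, Finset.mem_map]
    constructor
    · rintro ⟨⟨a, rfl, ha⟩, b, hb, hb'⟩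
      obtain rfl := e.injective hb
      refine ⟨b, ?_, rfl⟩
      rcases b with b | ⟨j, b⟩
      · simp
      · simp only [Sum.elim_inr] at ha hb'
        subst hb'
        simpa [hitSet] using ha
    · rintro ⟨a, ha, rfl⟩
      rcases a with b | ⟨j, b⟩
      · exact ⟨⟨_, rfl, trivial⟩, _, rfl, trivial⟩
      · simp only [Finset.inr_mem_disjSum, Finset.mem_image, hitSet, Finset.mem_filter,
          Finset.mem_univ, true_and, Prod.mk.injEq] at ha
        obtain ⟨j', hj', rfl, rfl⟩ := ha
        exact ⟨⟨_, rfl, hj'⟩, _, rfl, rfl⟩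
  rw [hamW, h1, Finset.card_map, Finset.card_disjSum, Finset.card_image_of_injective]
  · simp
  · intro j j' hj
    exact congrArg Prod.fst hj

/-- The product of the distances between all ordered pairs of distinct elements. -/
noncomputable def pairDist (S : Finset ℕ) : ℝ := ∏ s ∈ S, ∏ s' ∈ S.erase s, |(s : ℝ) - s'|

theorem pairDist_insert {a : ℕ} {R : Finset ℕ} (ha : a ∉ R) :
    pairDist (insert a R) = pairDist R * (∏ s ∈ R, |(a : ℝ) - s|) ^ 2 := by
  have h1 : ∀ s ∈ R, ∏ s' ∈ (insert a R).erase s, |(s : ℝ) - s'| =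
      |(a : ℝ) - s| * ∏ s' ∈ R.erase s, |(s : ℝ) - s'| := by
    intro s hs
    have hsa : a ≠ s := fun h => ha (h ▸ hs)
    rw [Finset.erase_insert_of_ne hsa, Finset.prod_insert (fun h => ha (Finset.mem_of_mem_erase h)),
      abs_sub_comm]
  rw [pairDist, Finset.prod_insert ha, Finset.erase_insert ha, Finset.prod_congr rfl h1,
    Finset.prod_mul_distrib, pairDist]
  ring

theorem one_le_abs_sub_of_ne {a b : ℕ} (h : a ≠ b) : (1 : ℝ) ≤ |(a : ℝ) - b| := by
  have : (1 : ℤ) ≤ |(a : ℤ) - b| := Int.one_le_abs (by omega)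
  exact_mod_cast this

theorem exists_fekete_or_pairDist (d A : ℕ) : ∀ Z : Finset ℕ, d + A ≤ Z.card →
    (∃ i ∈ Z, ∃ S ⊆ Z, S.card = d ∧ (∀ s ∈ S, i < s) ∧ ∀ s ∈ S,
      ∏ s' ∈ S.erase s, |(i : ℝ) - s'| ≤ 2 ^ d * ∏ s' ∈ S.erase s, |(s : ℝ) - s'|) ∨
    ∃ S ⊆ Z, S.card = d ∧ (4 : ℝ) ^ (d * A) ≤ pairDist S := by
  induction A with
  | zero =>
    intro Z hZ
    obtain ⟨S, hS, hc⟩ := Finset.exists_subset_card_eq (by simpa using hZ)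
    refine Or.inr ⟨S, hS, hc, ?_⟩
    rw [mul_zero, pow_zero]
    have : ∀ s ∈ S, (1 : ℝ) ≤ ∏ s' ∈ S.erase s, |(s : ℝ) - s'| := fun s _ => by
      rw [← Finset.prod_const_one (s := S.erase s)]
      exact Finset.prod_le_prod (fun _ _ => zero_le_one) fun s' hs' =>
        one_le_abs_sub_of_ne (Finset.ne_of_mem_erase hs').symm
    rw [pairDist, ← Finset.prod_const_one (s := S)]
    exact Finset.prod_le_prod (fun _ _ => zero_le_one) this
  | succ A ih =>
    intro Z hZ
    have hne : Z.Nonempty := Finset.card_pos.1 (by omega)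
    set i := Z.min' hne with hi
    have hiZ : i ∈ Z := Finset.min'_mem Z hne
    have hcard := Finset.card_erase_of_mem hiZ
    rcases ih (Z.erase i) (by omega) with ⟨i', hi', S, hS, h⟩ | ⟨S, hS, hSc, hSp⟩
    · exact Or.inl ⟨i', Finset.mem_of_mem_erase hi', S, hS.trans (Finset.erase_subset _ _), h⟩
    · have hlt : ∀ s ∈ S, i < s := fun s hs =>
        lt_of_le_of_ne (Finset.min'_le Z s (Finset.mem_of_mem_erase (hS hs)))
          (Finset.ne_of_mem_erase (hS hs)).symm
      by_cases hgood : ∀ s ∈ S,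
        ∏ s' ∈ S.erase s, |(i : ℝ) - s'| ≤ 2 ^ d * ∏ s' ∈ S.erase s, |(s : ℝ) - s'|
      · exact Or.inl ⟨i, hiZ, S, hS.trans (Finset.erase_subset _ _), hSc, hlt, hgood⟩
      · push Not at hgood
        obtain ⟨s, hs, hbad⟩ := hgood
        have hiS : i ∉ S.erase s := fun h => (hlt i (Finset.mem_of_mem_erase h)).ne rfl
        refine Or.inr ⟨insert i (S.erase s), ?_, ?_, ?_⟩
        · intro u hu
          rcases Finset.mem_insert.1 hu with rfl | hu
          · exact hiZ
          · exact Finset.mem_of_mem_erase (hS (Finset.mem_of_mem_erase hu))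
        · rw [Finset.card_insert_of_notMem hiS, Finset.card_erase_of_mem hs, hSc]
          have := Finset.card_pos.2 ⟨s, hs⟩
          omega
        · rw [pairDist_insert hiS]
          have h0 : 0 ≤ pairDist (S.erase s) :=
            Finset.prod_nonneg fun _ _ => Finset.prod_nonneg fun _ _ => abs_nonneg _
          have h1 : pairDist S = pairDist (S.erase s) *
              (∏ s' ∈ S.erase s, |(s : ℝ) - s'|) ^ 2 := by
            conv_lhs => rw [← Finset.insert_erase hs]
            exact pairDist_insert (Finset.notMem_erase s S)
          have h2 : (2 ^ d * ∏ s' ∈ S.erase s, |(s : ℝ) - s'|) ^ 2 ≤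
              (∏ s' ∈ S.erase s, |(i : ℝ) - s'|) ^ 2 :=
            pow_le_pow_left₀ (mul_nonneg (by positivity)
              (Finset.prod_nonneg fun _ _ => abs_nonneg _)) hbad.le 2
          have e4 : ((2 : ℝ) ^ d) ^ 2 = 4 ^ d := by rw [← pow_mul, mul_comm, pow_mul]; norm_num
          calc (4 : ℝ) ^ (d * (A + 1)) = 4 ^ d * 4 ^ (d * A) := by rw [← pow_add]; congr 1; ring
            _ ≤ 4 ^ d * pairDist S := by gcongr
            _ = pairDist (S.erase s) * (2 ^ d * ∏ s' ∈ S.erase s, |(s : ℝ) - s'|) ^ 2 := by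
                rw [h1, mul_pow, e4]; ring
            _ ≤ _ := mul_le_mul_of_nonneg_left h2 h0

/-- A one-sided Fekete-type selection: a point to the left of a well-spread set. -/
theorem exists_fekete {L d : ℕ} (hL : 1 ≤ L) (hd : 1 ≤ d) (Z : Finset ℕ)
    (hZ : ∀ a ∈ Z, ∀ b ∈ Z, |(a : ℝ) - b| ≤ 2 ^ L) (hcard : d * (L + 1) ≤ Z.card) :
    ∃ i ∈ Z, ∃ S ⊆ Z, S.card = d ∧ (∀ s ∈ S, i < s) ∧ ∀ s ∈ S,
      ∏ s' ∈ S.erase s, |(i : ℝ) - s'| ≤ 2 ^ d * ∏ s' ∈ S.erase s, |(s : ℝ) - s'| := by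
  rcases exists_fekete_or_pairDist d (L * d) Z (by nlinarith) with h | ⟨S, hS, hSc, hSp⟩
  · exact h
  · exfalso
    have h1 : pairDist S ≤ ((2 ^ L) ^ d) ^ d := by
      rw [pairDist, ← hSc, ← Finset.prod_const]
      refine Finset.prod_le_prod (fun _ _ => Finset.prod_nonneg fun _ _ => abs_nonneg _)
        fun s hs => ?_
      calc _ ≤ ∏ s' ∈ S.erase s, (2 : ℝ) ^ L :=
            Finset.prod_le_prod (fun _ _ => abs_nonneg _) fun s' hs' =>
              hZ _ (hS hs) _ (hS (Finset.mem_of_mem_erase hs'))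
        _ = (2 ^ L) ^ (S.erase s).card := Finset.prod_const _
        _ ≤ _ := pow_le_pow_right₀ (one_le_pow₀ (by norm_num))
          (Finset.card_le_card (Finset.erase_subset _ _))
    have h2 : (4 : ℝ) ^ (d * (L * d)) = 2 ^ (2 * (d * (L * d))) := by
      rw [pow_mul 2 2]; norm_num
    rw [h2] at hSp
    rw [← pow_mul, ← pow_mul] at h1
    have h3 := (pow_le_pow_iff_right₀ (by norm_num : (1 : ℝ) < 2)).1 (hSp.trans h1)
    have : 0 < L * d * d := by positivity
    nlinarith

/-- The nodal weights of divided differences. -/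
noncomputable def divDiffWeight (T : Finset ℕ) (s : ℕ) : ℝ := ∏ s' ∈ T.erase s, ((s : ℝ) - s')⁻¹

theorem divDiffWeight_sign (T : Finset ℕ) (s : ℕ) :
    0 < (-1) ^ (T.filter (s < ·)).card * divDiffWeight T s := by
  have h1 : (-1 : ℝ) ^ (T.filter (s < ·)).card = ∏ s' ∈ T.erase s, if s < s' then -1 else 1 := by
    rw [Finset.prod_ite, Finset.prod_const_one, mul_one, Finset.prod_const]
    congr 2
    ext u
    simp only [Finset.mem_filter, Finset.mem_erase]
    exact ⟨fun h => ⟨⟨h.2.ne', h.1⟩, h.2⟩, fun h => ⟨h.1.2, h.2⟩⟩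
  rw [h1, divDiffWeight, ← Finset.prod_mul_distrib]
  refine Finset.prod_pos fun u hu => ?_
  have hne := Finset.ne_of_mem_erase hu
  split_ifs with h
  · have : (s : ℝ) < u := by exact_mod_cast h
    have : ((s : ℝ) - u)⁻¹ < 0 := inv_lt_zero.2 (by linarith)
    linarith
  · have : (u : ℝ) < s := by exact_mod_cast lt_of_le_of_ne (not_lt.1 h) hne
    rw [one_mul]
    exact inv_pos.2 (by linarith)

theorem sum_divDiffWeight_mul_eval (T : Finset ℕ) (Q : Polynomial ℝ)
    (hQ : Q.natDegree + 1 < T.card) :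
    ∑ s ∈ T, divDiffWeight T s * Q.eval (s : ℝ) = 0 := by
  have h := Lagrange.coeff_eq_sum (s := T) (v := fun i : ℕ => (i : ℝ))
    (fun a _ b _ h => by simpa using h) (P := Q)
    (lt_of_le_of_lt Polynomial.degree_le_natDegree (by exact_mod_cast (by omega)))
  rw [Polynomial.coeff_eq_zero_of_natDegree_lt (by omega)] at h
  rw [h]
  refine Finset.sum_congr rfl fun s _ => ?_
  rw [divDiffWeight, Finset.prod_inv_distrib, mul_comm, div_eq_mul_inv]

theorem exists_choose_polynomial (t τ : ℕ) :
    ∃ Q : Polynomial ℝ, Q.natDegree ≤ τ ∧ ∀ i : ℕ, Q.eval ((t + i : ℕ) : ℝ) = i.choose τ := by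
  refine ⟨Polynomial.C ((τ.factorial : ℝ)⁻¹) *
    (descPochhammer ℝ τ).comp (Polynomial.X - Polynomial.C (t : ℝ)), ?_, fun i => ?_⟩
  · refine (Polynomial.natDegree_C_mul_le _ _).trans ?_
    rw [Polynomial.natDegree_comp, descPochhammer_natDegree, Polynomial.natDegree_X_sub_C, mul_one]
  · rw [Polynomial.eval_mul, Polynomial.eval_C, Polynomial.eval_comp, Polynomial.eval_sub,
      Polynomial.eval_X, Polynomial.eval_C, Nat.cast_add, add_sub_cancel_left,
      descPochhammer_eval_eq_descFactorial, Nat.descFactorial_eq_factorial_mul_choose]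
    push_cast
    rw [inv_mul_cancel_left₀]
    exact_mod_cast τ.factorial_ne_zero

theorem divDiffWeight_ratio {L d R i P : ℕ} {S E : Finset ℕ} {e : ℕ → ℕ} (hSc : S.card = d)
    (hlt : ∀ s ∈ S, i < s)
    (hfek : ∀ s ∈ S,
      ∏ s' ∈ S.erase s, |(i : ℝ) - s'| ≤ 2 ^ d * ∏ s' ∈ S.erase s, |(s : ℝ) - s'|)
    (hdiam : ∀ s ∈ S, ∀ s' ∈ S, |(s : ℝ) - s'| ≤ 2 ^ L)
    (hsep : ∀ s ∈ S, ∀ s' ∈ S, s < s' → s + 2 ≤ s')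
    (hE : E = S.filter (i + 2 * R < ·)) (hrem : L * (S \ E).card ≤ d)
    (hP : P ≤ i + R) (hP' : i ≤ P + R) (he : ∀ s, e s = s ∨ e s = s + 1) {s : ℕ} (hs : s ∈ E) :
    ∏ s' ∈ E.erase s, |(P : ℝ) - e s'| ≤
      16 ^ d * ∏ s' ∈ E.erase s, |(e s : ℝ) - e s'| := by
  have hES : E ⊆ S := hE ▸ Finset.filter_subset _ _
  have hcE : ∀ u, (E.erase u).card ≤ d := fun u =>
    (Finset.card_le_card ((Finset.erase_subset _ _).trans hES)).trans hSc.le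
  have hsS := hES hs
  have hecast : ∀ u : ℕ, (u : ℝ) ≤ e u ∧ (e u : ℝ) ≤ u + 1 := fun u => by
    rcases he u with h | h <;> rw [h] <;> push_cast <;> constructor <;> linarith
  have h1 : ∏ s' ∈ E.erase s, |(P : ℝ) - e s'| ≤ ∏ s' ∈ E.erase s, (2 * |(i : ℝ) - s'|) := by
    refine Finset.prod_le_prod (fun _ _ => abs_nonneg _) fun u hu => ?_
    have hu := Finset.mem_of_mem_erase hu
    rw [hE, Finset.mem_filter] at hu
    have c1 : (i : ℝ) + 2 * R + 1 ≤ u := by exact_mod_cast hu.2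
    have c2 : (P : ℝ) ≤ i + R := by exact_mod_cast hP
    have c3 : (i : ℝ) ≤ P + R := by exact_mod_cast hP'
    have c4 : (0 : ℝ) ≤ R := by positivity
    have := hecast u
    rw [abs_of_nonpos (by linarith), abs_of_nonpos (by linarith)]
    linarith
  have h2 : ∏ s' ∈ E.erase s, |(s : ℝ) - s'| ≤ ∏ s' ∈ E.erase s, (2 * |(e s : ℝ) - e s'|) := by
    refine Finset.prod_le_prod (fun _ _ => abs_nonneg _) fun u hu => ?_
    have huE := hES (Finset.mem_of_mem_erase hu)
    have b1 := hecast s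
    have b2 := hecast u
    rcases lt_or_gt_of_ne (Finset.ne_of_mem_erase hu) with h | h
    · have : (u : ℝ) + 2 ≤ s := by exact_mod_cast hsep u huE s hsS h
      rw [abs_of_nonneg (by linarith), abs_of_nonneg (by linarith)]
      linarith
    · have : (s : ℝ) + 2 ≤ u := by exact_mod_cast hsep s hsS u huE h
      rw [abs_of_nonpos (by linarith), abs_of_nonpos (by linarith)]
      linarith
  have hsub : E.erase s ⊆ S.erase s := Finset.erase_subset_erase s hES
  have hsd : S.erase s \ E.erase s ⊆ S \ E := by
    intro u
    simp only [Finset.mem_sdiff, Finset.mem_erase]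
    tauto
  have h3 : ∏ s' ∈ E.erase s, |(i : ℝ) - s'| ≤ ∏ s' ∈ S.erase s, |(i : ℝ) - s'| := by
    rw [← Finset.prod_sdiff hsub]
    refine le_mul_of_one_le_left (Finset.prod_nonneg fun _ _ => abs_nonneg _) ?_
    rw [← Finset.prod_const_one (s := S.erase s \ E.erase s)]
    refine Finset.prod_le_prod (fun _ _ => zero_le_one) fun u hu => ?_
    exact one_le_abs_sub_of_ne (hlt u (Finset.sdiff_subset (hsd hu))).ne
  have h4 : ∏ s' ∈ S.erase s, |(s : ℝ) - s'| ≤ 2 ^ d * ∏ s' ∈ E.erase s, |(s : ℝ) - s'| := by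
    rw [← Finset.prod_sdiff hsub]
    refine mul_le_mul_of_nonneg_right ?_ (Finset.prod_nonneg fun _ _ => abs_nonneg _)
    calc _ ≤ ∏ s' ∈ S.erase s \ E.erase s, (2 : ℝ) ^ L :=
          Finset.prod_le_prod (fun _ _ => abs_nonneg _) fun u hu =>
            hdiam _ hsS _ (Finset.sdiff_subset (hsd hu))
      _ = 2 ^ (L * (S.erase s \ E.erase s).card) := by rw [Finset.prod_const, pow_mul]
      _ ≤ 2 ^ d := pow_le_pow_right₀ (by norm_num)
          ((Nat.mul_le_mul_left L (Finset.card_le_card hsd)).trans hrem)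
  rw [Finset.prod_mul_distrib, Finset.prod_const] at h1 h2
  have h5 : (2 : ℝ) ^ (E.erase s).card ≤ 2 ^ d := pow_le_pow_right₀ (by norm_num) (hcE s)
  have p1 : 0 ≤ ∏ s' ∈ E.erase s, |(i : ℝ) - s'| := Finset.prod_nonneg fun _ _ => abs_nonneg _
  have p2 : 0 ≤ ∏ s' ∈ E.erase s, |(e s : ℝ) - e s'| := Finset.prod_nonneg fun _ _ => abs_nonneg _
  calc _ ≤ 2 ^ (E.erase s).card * ∏ s' ∈ E.erase s, |(i : ℝ) - s'| := h1
    _ ≤ 2 ^ d * ∏ s' ∈ S.erase s, |(i : ℝ) - s'| := by gcongr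
    _ ≤ 2 ^ d * (2 ^ d * ∏ s' ∈ S.erase s, |(s : ℝ) - s'|) := by gcongr; exact hfek s hsS
    _ ≤ 2 ^ d * (2 ^ d * (2 ^ d * ∏ s' ∈ E.erase s, |(s : ℝ) - s'|)) := by gcongr
    _ ≤ 2 ^ d * (2 ^ d * (2 ^ d * (2 ^ d * ∏ s' ∈ E.erase s, |(e s : ℝ) - e s'|))) := by
        gcongr
        exact h2.trans (mul_le_mul_of_nonneg_right h5 p2)
    _ = (2 * 2 * 2 * 2) ^ d * ∏ s' ∈ E.erase s, |(e s : ℝ) - e s'| := by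
        rw [mul_pow, mul_pow, mul_pow]; ring
    _ = _ := by norm_num

theorem abs_divDiffWeight (T : Finset ℕ) (s : ℕ) :
    |divDiffWeight T s| = (∏ s' ∈ T.erase s, |(s : ℝ) - s'|)⁻¹ := by
  rw [divDiffWeight, Finset.abs_prod, ← Finset.prod_inv_distrib]
  simp only [abs_inv]

theorem sum_abs_divDiffWeight_le {d P : ℕ} {E : Finset ℕ} {e : ℕ → ℕ} (hEd : E.card ≤ d)
    (hPe : ∀ s ∈ E, P < e s) (hinj : Set.InjOn e E)
    (hratio : ∀ s ∈ E, ∏ s' ∈ E.erase s, |(P : ℝ) - e s'| ≤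
      16 ^ d * ∏ s' ∈ E.erase s, |(e s : ℝ) - e s'|) :
    ∑ s ∈ insert P (E.image e), |divDiffWeight (insert P (E.image e)) s| ≤
      32 ^ d * |divDiffWeight (insert P (E.image e)) P| := by
  have hPn : P ∉ E.image e := by
    rw [Finset.mem_image]
    rintro ⟨s, hs, h⟩
    exact (hPe s hs).ne' h
  set T := insert P (E.image e) with hT
  have hTP : T.erase P = E.image e := Finset.erase_insert hPn
  have key : ∀ s ∈ E, |divDiffWeight T (e s)| ≤ 16 ^ d * |divDiffWeight T P| := by
    intro s hs
    have hTs : T.erase (e s) = insert P ((E.erase s).image e) := by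
      ext u
      simp only [hT, Finset.mem_erase, Finset.mem_insert, Finset.mem_image]
      constructor
      · rintro ⟨h1, h2 | ⟨v, hv, rfl⟩⟩
        · exact Or.inl h2
        · exact Or.inr ⟨v, ⟨fun h => h1 (h ▸ rfl), hv⟩, rfl⟩
      · rintro (rfl | ⟨v, ⟨hv, hvE⟩, rfl⟩)
        · exact ⟨(hPe s hs).ne, Or.inl rfl⟩
        · exact ⟨fun h => hv (hinj hvE hs h), Or.inr ⟨v, hvE, rfl⟩⟩
    have hPn' : P ∉ (E.erase s).image e := fun h =>
      hPn (Finset.image_subset_image (Finset.erase_subset _ _) h)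
    have hinj' : Set.InjOn e (E.erase s) := hinj.mono (by simp)
    rw [abs_divDiffWeight, abs_divDiffWeight, hTs, hTP, Finset.prod_insert hPn',
      Finset.prod_image hinj', Finset.prod_image hinj, ← Finset.mul_prod_erase _ _ hs,
      abs_sub_comm (e s : ℝ) P]
    have hq : 0 < |(P : ℝ) - e s| := by
      have : (P : ℝ) < e s := by exact_mod_cast hPe s hs
      exact abs_pos.2 (by linarith)
    have hA : 0 < ∏ s' ∈ E.erase s, |(P : ℝ) - e s'| := Finset.prod_pos fun u hu => by
      have : (P : ℝ) < e u := by exact_mod_cast hPe u (Finset.mem_of_mem_erase hu)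
      exact abs_pos.2 (by linarith)
    have hr := hratio s hs
    have hB : 0 < ∏ s' ∈ E.erase s, |(e s : ℝ) - e s'| := by
      by_contra hcon
      have : (16 : ℝ) ^ d * ∏ s' ∈ E.erase s, |(e s : ℝ) - e s'| ≤ 0 :=
        mul_nonpos_of_nonneg_of_nonpos (by positivity) (not_lt.1 hcon)
      linarith
    rw [← div_eq_mul_inv, inv_eq_one_div, div_le_div_iff₀ (by positivity) (by positivity)]
    nlinarith
  rw [Finset.sum_insert hPn, Finset.sum_image hinj]
  have h1 : ∑ s ∈ E, |divDiffWeight T (e s)| ≤ d * (16 ^ d * |divDiffWeight T P|) := by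
    refine (Finset.sum_le_card_nsmul _ _ _ key).trans ?_
    rw [nsmul_eq_mul]
    exact mul_le_mul_of_nonneg_right (by exact_mod_cast hEd) (by positivity)
  have h2 : (d : ℝ) + 1 ≤ 2 ^ d := by exact_mod_cast d.lt_two_pow_self
  have h3 : (1 : ℝ) ≤ 16 ^ d := one_le_pow₀ (by norm_num)
  have h4 : (1 : ℝ) + d * 16 ^ d ≤ 32 ^ d := by
    rw [show (32 : ℝ) = 2 * 16 by norm_num, mul_pow]
    nlinarith
  nlinarith [mul_le_mul_of_nonneg_right h4 (abs_nonneg (divDiffWeight T P))]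

/-- A dual polynomial with many vanishing moments, the signs of `D`, and large mass at one
point `P`. -/
theorem exists_dual {L d R i P t m n : ℕ} {S : Finset ℕ} {D : ℕ → ℤ} (hSc : S.card = d)
    (hlt : ∀ s ∈ S, i < s)
    (hfek : ∀ s ∈ S,
      ∏ s' ∈ S.erase s, |(i : ℝ) - s'| ≤ 2 ^ d * ∏ s' ∈ S.erase s, |(s : ℝ) - s'|)
    (hdiam : ∀ s ∈ S, ∀ s' ∈ S, |(s : ℝ) - s'| ≤ 2 ^ L)
    (hsep : ∀ s ∈ S, ∀ s' ∈ S, s < s' → s + 2 ≤ s')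
    (hD : ∀ j ≤ n, D j = 1 ∨ D j = -1) (hchange : ∀ s ∈ S, D s ≠ D (s + 1))
    (hn : ∀ s ∈ S, s + 1 ≤ n) (hrem : L * (S \ S.filter (i + 2 * R < ·)).card ≤ d)
    (hP : P ≤ i + R) (hP' : i ≤ P + R) (hPn : P ≤ n) (htP : t ≤ P) (hPt : P ≤ t + m)
    (hSt : ∀ s ∈ S, s + 1 ≤ t + m) :
    ∃ Ψ : ℕ → ℝ, ∑ j ∈ Finset.range (m + 1), |Ψ j| ≤ 1 ∧
      (∀ τ < (S.filter (i + 2 * R < ·)).card,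
        ∑ j ∈ Finset.range (m + 1), Ψ j * j.choose τ = 0) ∧
      (∀ j ≤ m, 0 ≤ Ψ j * D (t + j)) ∧ (1 / 32) ^ d ≤ |Ψ (P - t)| := by
  set E := S.filter (i + 2 * R < ·) with hE
  have hES : E ⊆ S := Finset.filter_subset _ _
  set e : ℕ → ℕ := fun s =>
    if D s = (-1) ^ (1 + (E.filter (· < s)).card) * D P then s else s + 1 with he
  have he' : ∀ s, e s = s ∨ e s = s + 1 := fun s => by
    simp only [he]
    split_ifs <;> simp
  have hDP := hD P hPn
  have hDe : ∀ s ∈ E, D (e s) = (-1) ^ (1 + (E.filter (· < s)).card) * D P := by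
    intro s hs
    simp only [he]
    split_ifs with h
    · exact h
    · have h1 := hD s (by have := hn s (hES hs); omega)
      have h2 := hD (s + 1) (hn s (hES hs))
      have h3 := hchange s (hES hs)
      rcases neg_one_pow_eq_or ℤ (1 + (E.filter (· < s)).card) with h4 | h4 <;> rw [h4] at h ⊢ <;>
        omega
  have hmono : ∀ s ∈ E, ∀ s' ∈ E, s < s' → e s < e s' := by
    intro s hs s' hs' h
    have := hsep s (hES hs) s' (hES hs') h
    rcases he' s with h1 | h1 <;> rcases he' s' with h2 | h2 <;> omega
  have hinj : Set.InjOn e E := by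
    intro s hs s' hs' h
    by_contra hne
    rcases lt_or_gt_of_ne hne with h1 | h1
    · exact (hmono s hs s' hs' h1).ne h
    · exact (hmono s' hs' s hs h1).ne' h
  have hPe : ∀ s ∈ E, P < e s := by
    intro s hs
    have := (Finset.mem_filter.1 hs).2
    rcases he' s with h1 | h1 <;> omega
  have hPn' : P ∉ E.image e := by
    rw [Finset.mem_image]
    rintro ⟨s, hs, h⟩
    exact (hPe s hs).ne' h
  have hbound := sum_abs_divDiffWeight_le ((Finset.card_le_card hES).trans hSc.le) hPe hinj
    fun s hs => divDiffWeight_ratio hSc hlt hfek hdiam hsep hE hrem hP hP' he' hs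
  set T := insert P (E.image e) with hT
  set Ω := ∑ s ∈ T, |divDiffWeight T s| with hΩ
  have hcardT : T.card = E.card + 1 := by
    rw [hT, Finset.card_insert_of_notMem hPn', Finset.card_image_of_injOn hinj]
  have hTt : ∀ s ∈ T, t ≤ s ∧ s ≤ t + m := by
    intro s hs
    rw [hT, Finset.mem_insert, Finset.mem_image] at hs
    rcases hs with rfl | ⟨u, hu, rfl⟩
    · exact ⟨htP, hPt⟩
    · have h1 := hPe u hu
      have h2 := hSt u (hES hu)
      rcases he' u with h3 | h3 <;> omega
  have hPT : P ∈ T := Finset.mem_insert_self _ _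
  have hωP : 0 < |divDiffWeight T P| := by
    have := divDiffWeight_sign T P
    refine abs_pos.2 fun h => ?_
    simp [h] at this
  have hΩ0 : 0 < Ω := lt_of_lt_of_le hωP
    (Finset.single_le_sum (f := fun s => |divDiffWeight T s|) (fun _ _ => abs_nonneg _) hPT)
  have hsgn : ∀ s ∈ T, 0 < (-1) ^ E.card * (D P : ℝ) * divDiffWeight T s * D s := by
    intro s hs
    have hpos := divDiffWeight_sign T s
    rw [hT, Finset.mem_insert, Finset.mem_image] at hs
    have hDP2 : (D P : ℝ) * D P = 1 := by rcases hDP with h | h <;> rw [h] <;> norm_num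
    rcases hs with rfl | ⟨u, hu, rfl⟩
    · have : T.filter (s < ·) = E.image e := by
        ext v
        simp only [hT, Finset.mem_filter, Finset.mem_insert]
        constructor
        · rintro ⟨rfl | h, h2⟩
          · omega
          · exact h
        · intro h
          refine ⟨Or.inr h, ?_⟩
          obtain ⟨w, hw, rfl⟩ := Finset.mem_image.1 h
          exact hPe w hw
      rw [this, Finset.card_image_of_injOn hinj] at hpos
      calc _ < _ := hpos
        _ = (-1) ^ E.card * divDiffWeight T s * ((D s : ℝ) * D s) := by rw [hDP2, mul_one]
        _ = _ := by ring
    · have hf : T.filter (e u < ·) = (E.filter (u < ·)).image e := by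
        ext v
        simp only [hT, Finset.mem_filter, Finset.mem_insert, Finset.mem_image]
        constructor
        · rintro ⟨rfl | ⟨w, hw, rfl⟩, h2⟩
          · have := hPe u hu; omega
          · refine ⟨w, ⟨hw, ?_⟩, rfl⟩
            by_contra hcon
            rcases (not_lt.1 hcon).lt_or_eq with h | h
            · have := hmono w hw u hu h; omega
            · rw [h] at h2; omega
        · rintro ⟨w, ⟨hw, h⟩, rfl⟩
          exact ⟨Or.inr ⟨w, hw, rfl⟩, hmono u hu w hw h⟩
      have hc : E.card = 1 + (E.filter (· < u)).card + (E.filter (u < ·)).card := by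
        have h1 := Finset.card_filter_add_card_filter_not (s := E) (· < u)
        have h2 : E.filter (fun v => ¬ v < u) = insert u (E.filter (u < ·)) := by
          ext v
          simp only [Finset.mem_filter, Finset.mem_insert, not_lt]
          constructor
          · rintro ⟨h, h'⟩
            rcases h'.lt_or_eq with h'' | h''
            · exact Or.inr ⟨h, h''⟩
            · exact Or.inl h''.symm
          · rintro (rfl | h)
            · exact ⟨hu, le_rfl⟩
            · exact ⟨h.1, h.2.le⟩
        rw [h2, Finset.card_insert_of_notMem (by simp)] at h1
        omega
      rw [hf, Finset.card_image_of_injOn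
        (hinj.mono (Finset.coe_subset.2 (Finset.filter_subset _ _)))] at hpos
      have hDr : (D (e u) : ℝ) = (-1) ^ (1 + (E.filter (· < u)).card) * D P := by
        rw [hDe u hu]; push_cast; rfl
      have hsq : ((-1 : ℝ) ^ (1 + (E.filter (· < u)).card)) ^ 2 = 1 := by
        rw [← pow_mul, mul_comm, pow_mul]; norm_num
      rw [hDr]
      conv_rhs => rw [hc, pow_add]
      calc _ < _ := hpos
        _ = ((-1 : ℝ) ^ (1 + (E.filter (· < u)).card)) ^ 2 * ((D P : ℝ) * D P) *
            ((-1) ^ (E.filter (u < ·)).card * divDiffWeight T (e u)) := by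
              rw [hsq, hDP2]; ring
        _ = _ := by ring
  have habs : |(-1) ^ E.card * (D P : ℝ)| = 1 := by
    rw [abs_mul, abs_pow, abs_neg, abs_one, one_pow, one_mul]
    rcases hDP with h | h <;> rw [h] <;> norm_num
  set ψ : ℕ → ℝ := fun s =>
    if s ∈ T then (-1) ^ E.card * (D P : ℝ) * divDiffWeight T s / Ω else 0 with hψ
  have hTsub : T ⊆ Finset.Ico t (t + (m + 1)) := fun s hs => by
    have := hTt s hs
    rw [Finset.mem_Ico]; omega
  have hsumT : ∀ g : ℕ → ℝ, ∑ j ∈ Finset.range (m + 1), (if t + j ∈ T then g (t + j) else 0) =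
      ∑ s ∈ T, g s := by
    intro g
    have := Finset.sum_Ico_eq_sum_range (fun s => if s ∈ T then g s else 0) t (t + (m + 1))
    rw [Nat.add_sub_cancel_left] at this
    rw [← this, ← Finset.sum_filter, Finset.filter_mem_eq_inter, Finset.inter_eq_right.2 hTsub]
  refine ⟨fun j => ψ (t + j), ?_, ?_, ?_, ?_⟩
  · have : ∀ j, |ψ (t + j)| = if t + j ∈ T then |divDiffWeight T (t + j)| / Ω else 0 := by
      intro j
      simp only [hψ]
      split_ifs
      · rw [abs_div, abs_mul, habs, one_mul, abs_of_pos hΩ0]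
      · exact abs_zero
    simp only [this]
    rw [hsumT fun s => |divDiffWeight T s| / Ω, ← Finset.sum_div, ← hΩ, div_self hΩ0.ne']
  · intro τ hτ
    obtain ⟨Q, hQ, hQe⟩ := exists_choose_polynomial t τ
    have : ∀ j, ψ (t + j) * j.choose τ =
        if t + j ∈ T then (-1) ^ E.card * (D P : ℝ) / Ω *
          (divDiffWeight T (t + j) * Q.eval ((t + j : ℕ) : ℝ)) else 0 := by
      intro j
      simp only [hψ]
      rw [← hQe]
      split_ifs
      · ring
      · ring
    simp only [this]
    rw [hsumT fun s => (-1) ^ E.card * (D P : ℝ) / Ω * (divDiffWeight T s * Q.eval (s : ℝ)),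
      ← Finset.mul_sum, sum_divDiffWeight_mul_eval T Q (by omega), mul_zero]
  · intro j _
    simp only [hψ]
    split_ifs with h
    · rw [div_mul_eq_mul_div]
      exact (div_pos (hsgn _ h) hΩ0).le
    · simp
  · simp only [hψ]
    rw [Nat.add_sub_cancel' htP, if_pos hPT, abs_div, abs_mul, habs, one_mul, abs_of_pos hΩ0,
      le_div_iff₀ hΩ0, one_div, inv_pow, inv_mul_le_iff₀ (by positivity)]
    exact hbound

/-- A dual polynomial dominating the binomial weights on a window. -/
theorem exists_mixed_dual {L d R i t m n : ℕ} {S : Finset ℕ} {D : ℕ → ℤ} (hSc : S.card = d)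
    (hlt : ∀ s ∈ S, i < s)
    (hfek : ∀ s ∈ S,
      ∏ s' ∈ S.erase s, |(i : ℝ) - s'| ≤ 2 ^ d * ∏ s' ∈ S.erase s, |(s : ℝ) - s'|)
    (hdiam : ∀ s ∈ S, ∀ s' ∈ S, |(s : ℝ) - s'| ≤ 2 ^ L)
    (hsep : ∀ s ∈ S, ∀ s' ∈ S, s < s' → s + 2 ≤ s')
    (hD : ∀ j ≤ n, D j = 1 ∨ D j = -1) (hchange : ∀ s ∈ S, D s ≠ D (s + 1))
    (hn : ∀ s ∈ S, s + 1 ≤ n) (hrem : L * (S \ S.filter (i + 2 * R < ·)).card ≤ d)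
    (htn : t + m ≤ n) (hSt : ∀ s ∈ S, s + 1 ≤ t + m)
    {lam ρ q : ℝ} (hq0 : 0 ≤ q) (hq1 : q ≤ 1)
    (hwin : ∀ j ≤ m, |(j : ℝ) - lam| ≤ ρ → t + j ≤ i + R ∧ i ≤ t + j + R) :
    ∃ Ψ : ℕ → ℝ, ∑ j ∈ Finset.range (m + 1), |Ψ j| ≤ 1 ∧
      (∀ τ < (S.filter (i + 2 * R < ·)).card,
        ∑ j ∈ Finset.range (m + 1), Ψ j * j.choose τ = 0) ∧
      (∀ j ≤ m, 0 ≤ Ψ j * D (t + j)) ∧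
      ∀ j ≤ m, |(j : ℝ) - lam| ≤ ρ →
        (1 / 32) ^ d * (m.choose j * (q ^ j * (1 - q) ^ (m - j))) ≤ |Ψ j| := by
  classical
  set G := (Finset.range (m + 1)).filter fun j : ℕ => |(j : ℝ) - lam| ≤ ρ with hG
  have hex : ∀ k, ∃ Ψ : ℕ → ℝ, k ∈ G → ∑ j ∈ Finset.range (m + 1), |Ψ j| ≤ 1 ∧
      (∀ τ < (S.filter (i + 2 * R < ·)).card,
        ∑ j ∈ Finset.range (m + 1), Ψ j * j.choose τ = 0) ∧
      (∀ j ≤ m, 0 ≤ Ψ j * D (t + j)) ∧ (1 / 32) ^ d ≤ |Ψ k| := by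
    intro k
    by_cases hk : k ∈ G
    · rw [hG, Finset.mem_filter, Finset.mem_range] at hk
      have hkm : k ≤ m := by omega
      obtain ⟨h1, h2⟩ := hwin k hkm hk.2
      obtain ⟨Ψ, h⟩ := exists_dual (P := t + k) (t := t) hSc hlt hfek hdiam hsep hD hchange hn hrem
        h1 h2 (by omega) (by omega) (by omega) hSt
      rw [Nat.add_sub_cancel_left] at h
      exact ⟨Ψ, fun _ => h⟩
    · exact ⟨0, fun h => absurd h hk⟩
  choose Φ hΦ using hex
  set μ : ℕ → ℝ := fun k => m.choose k * (q ^ k * (1 - q) ^ (m - k)) with hμ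
  have hμ0 : ∀ k, 0 ≤ μ k := fun k =>
    mul_nonneg (Nat.cast_nonneg _) (mul_nonneg (pow_nonneg hq0 _) (pow_nonneg (by linarith) _))
  have hμ1 : ∑ k ∈ G, μ k ≤ 1 := by
    have h1 : ∑ k ∈ Finset.range (m + 1), μ k = 1 := by
      have := add_pow q (1 - q) m
      rw [add_sub_cancel, one_pow] at this
      rw [this]
      exact Finset.sum_congr rfl fun k _ => by simp only [hμ]; ring
    rw [← h1]
    exact Finset.sum_le_sum_of_subset_of_nonneg (Finset.filter_subset _ _) fun k _ _ => hμ0 k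
  have hterm : ∀ k ∈ G, ∀ j ≤ m, 0 ≤ μ k * Φ k j * D (t + j) := fun k hk j hj => by
    rw [mul_assoc]
    exact mul_nonneg (hμ0 k) ((hΦ k hk).2.2.1 j hj)
  refine ⟨fun j => ∑ k ∈ G, μ k * Φ k j, ?_, ?_, ?_, ?_⟩
  · calc _ ≤ ∑ j ∈ Finset.range (m + 1), ∑ k ∈ G, μ k * |Φ k j| := by
          refine Finset.sum_le_sum fun j _ => (Finset.abs_sum_le_sum_abs _ _).trans_eq ?_
          exact Finset.sum_congr rfl fun k _ => by rw [abs_mul, abs_of_nonneg (hμ0 k)]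
      _ = ∑ k ∈ G, μ k * ∑ j ∈ Finset.range (m + 1), |Φ k j| := by
          rw [Finset.sum_comm]; simp only [Finset.mul_sum]
      _ ≤ ∑ k ∈ G, μ k := Finset.sum_le_sum fun k hk =>
          mul_le_of_le_one_right (hμ0 k) (hΦ k hk).1
      _ ≤ 1 := hμ1
  · intro τ hτ
    calc _ = ∑ k ∈ G, μ k * ∑ j ∈ Finset.range (m + 1), Φ k j * j.choose τ := by
          simp only [Finset.sum_mul, Finset.mul_sum]
          rw [Finset.sum_comm]
          simp only [mul_assoc]
      _ = 0 := Finset.sum_eq_zero fun k hk => by rw [(hΦ k hk).2.1 τ hτ, mul_zero]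
  · intro j hj
    rw [Finset.sum_mul]
    exact Finset.sum_nonneg fun k hk => hterm k hk j hj
  · intro j hj hjρ
    have hjG : j ∈ G := by rw [hG, Finset.mem_filter, Finset.mem_range]; exact ⟨by omega, hjρ⟩
    have hDabs : |(D (t + j) : ℝ)| = 1 := by
      rcases hD (t + j) (by omega) with h | h <;> rw [h] <;> norm_num
    have h1 : μ j * Φ j j * D (t + j) ≤ ∑ k ∈ G, μ k * Φ k j * D (t + j) :=
      Finset.single_le_sum (f := fun k => μ k * Φ k j * D (t + j))
        (fun k hk => hterm k hk j hj) hjG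
    calc (1 / 32) ^ d * μ j ≤ |Φ j j| * μ j :=
          mul_le_mul_of_nonneg_right (hΦ j hjG).2.2.2 (hμ0 j)
      _ = |μ j * Φ j j * D (t + j)| := by
          rw [abs_mul, hDabs, mul_one, abs_mul, abs_of_nonneg (hμ0 j), mul_comm]
      _ = μ j * Φ j j * D (t + j) := abs_of_nonneg (hterm j hjG j hj)
      _ ≤ _ := h1
      _ = (∑ k ∈ G, μ k * Φ k j) * D (t + j) := by rw [Finset.sum_mul]
      _ ≤ |(∑ k ∈ G, μ k * Φ k j) * D (t + j)| := le_abs_self _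
      _ = _ := by rw [abs_mul, hDabs, mul_one]

/-- The rank bound from a set of sign changes of small diameter with no dense windows. -/
theorem two_pow_le_rank_of_sparse {n r m ℓ w d L κ R W : ℕ} {D : ℕ → ℤ} (hr : 0 < r)
    (hW1 : 1 ≤ W) (hW : 4 / (W : ℝ) ≤ ((1 / 2) ^ 18) ^ 2)
    (U V : (Fin n → Bool) → Fin r → ℝ)
    (hUV : ∀ x y, 0 < (∑ i, U x i * V y i) * (D (hamW (band x y)) : ℝ))
    (hD : ∀ j ≤ n, D j = 1 ∨ D j = -1) {Z : Finset ℕ} (hchange : ∀ s ∈ Z, D s ≠ D (s + 1))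
    (hsep : ∀ s ∈ Z, ∀ s' ∈ Z, s < s' → s + 2 ≤ s') (hw : ∀ s ∈ Z, w ≤ s ∧ s + w ≤ n)
    (hℓ : 2 * W ≤ ℓ) (hm : 1 ≤ m) (hmw : m * ℓ ≤ w)
    (hreach : ∀ s ∈ Z, ∀ s' ∈ Z, 2 * (s' + 1) ≤ 2 * s + m) (hL : 2 ≤ L)
    (hdiam : ∀ s ∈ Z, ∀ s' ∈ Z, |(s : ℝ) - s'| ≤ 2 ^ L) (hcard : d * (L + 1) ≤ Z.card)
    (hκ : κ ≤ d) (hd : 1 ≤ d)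
    (hsparse : ∀ a ∈ Z, L * (Z.filter fun s => a ≤ s ∧ s ≤ a + 2 * R).card ≤ d)
    {lam ρ : ℝ} (hlam : lam = m * ((W : ℝ) / ℓ)) (hρ0 : 0 ≤ ρ) (hρ : ρ ≤ 2 * lam)
    (hρR : ρ + 2 ≤ R) (hexp : 2 * Real.exp (-(ρ ^ 2 / (4 * lam))) ≤ (1 / 2) ^ κ / 8) :
    2 ^ κ ≤ r := by
  obtain ⟨i, hiZ, S, hSZ, hSc, hlt, hfek⟩ := exists_fekete (by omega) hd Z hdiam hcard
  have hℓ0 : (0 : ℝ) < ℓ := by exact_mod_cast (by omega : 0 < ℓ)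
  have hm0 : (0 : ℝ) < m := by exact_mod_cast hm
  set q : ℝ := (W : ℝ) / ℓ with hq
  have hW0 : (0 : ℝ) < W := by exact_mod_cast hW1
  have hq0 : 0 < q := by positivity
  have hq2 : q ≤ 1 / 2 := by
    rw [hq, div_le_div_iff₀ hℓ0 (by norm_num)]
    have : ((2 * W : ℕ) : ℝ) ≤ ℓ := by exact_mod_cast hℓ
    push_cast at this
    linarith
  have hlam0 : 0 < lam := by rw [hlam]; positivity
  have hlam2 : 2 * lam ≤ m := by rw [hlam]; nlinarith
  have hfl := Nat.floor_le hlam0.le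
  have hfl' := Nat.lt_floor_add_one lam
  have hfl2 : 2 * ⌊lam⌋₊ ≤ m := by
    have : ((2 * ⌊lam⌋₊ : ℕ) : ℝ) ≤ m := by push_cast; linarith
    exact_mod_cast this
  have hmw' : m ≤ w := (Nat.le_mul_of_pos_right m (by omega)).trans hmw
  have hiw := hw i hiZ
  obtain ⟨t, ht⟩ : ∃ t, t + ⌊lam⌋₊ = i := ⟨i - ⌊lam⌋₊, by omega⟩
  have htn : t + m * ℓ ≤ n := by omega
  have hmℓ : m ≤ m * ℓ := Nat.le_mul_of_pos_right m (by omega)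
  have hEsub : S \ S.filter (i + 2 * R < ·) ⊆ Z.filter fun s => i ≤ s ∧ s ≤ i + 2 * R := by
    intro s hs
    simp only [Finset.mem_sdiff, Finset.mem_filter, not_and, not_lt] at hs ⊢
    exact ⟨hSZ hs.1, (hlt s hs.1).le, hs.2 hs.1⟩
  have hrem : L * (S \ S.filter (i + 2 * R < ·)).card ≤ d :=
    (Nat.mul_le_mul_left L (Finset.card_le_card hEsub)).trans (hsparse i hiZ)
  have hti : (i : ℝ) = t + ⌊lam⌋₊ := by exact_mod_cast ht.symm
  obtain ⟨Ψ, h1, h2, h3, h4⟩ := exists_mixed_dual (t := t) (m := m) (lam := lam) (ρ := ρ) (q := q)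
    (R := R) (L := L) (n := n) (D := D) hSc hlt hfek
    (fun s hs s' hs' => hdiam s (hSZ hs) s' (hSZ hs'))
    (fun s hs s' hs' => hsep s (hSZ hs) s' (hSZ hs')) hD (fun s hs => hchange s (hSZ hs))
    (fun s hs => by have := hw s (hSZ hs); omega) hrem (by omega)
    (fun s hs => by have := hreach i hiZ s (hSZ hs); omega) hq0.le (by linarith)
    (fun j hj hjρ => by
      rw [abs_le] at hjρ
      constructor
      · have : ((t + j : ℕ) : ℝ) ≤ ((i + R : ℕ) : ℝ) := by push_cast; linarith
        exact_mod_cast this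
      · have : (i : ℝ) ≤ ((t + j + R : ℕ) : ℝ) := by push_cast; linarith
        exact_mod_cast this)
  obtain ⟨X, Y, hXY⟩ := exists_block_embedding (m := m) (ℓ := ℓ) W htn
  have hbound := block_rank_bound hr hℓ hW1 (fun x => U (X x)) (fun y => V (Y y))
    (fun x y h => by have := hUV (X x) (Y y); rw [h, zero_mul] at this; exact lt_irrefl _ this)
    h2 h1 (fun x y => by
      have hu := hUV (X x) (Y y)
      rw [hXY] at hu
      have hcm : (hitSet W x y).card ≤ m := by
        simpa using Finset.card_le_univ (hitSet W x y)
      have hs := h3 _ hcm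
      rcases hD (t + (hitSet W x y).card) (by omega) with h | h <;> rw [h] at hu hs <;>
        push_cast at hu hs <;> nlinarith)
    hlam hlam0 hρ0 hρ (γ := (1 / 32) ^ d) (by positivity) h4 (θ := (1 / 2) ^ 18) (by positivity)
    (pow_le_one₀ (by norm_num) (by norm_num)) hW
  by_contra hcon
  have hr0 : (0 : ℝ) < r := by exact_mod_cast hr
  have hrκ : (r : ℝ) < 2 ^ κ := by exact_mod_cast not_le.1 hcon
  have hcardE : d ≤ 2 * (S.filter (i + 2 * R < ·)).card := by
    have := Finset.card_sdiff_add_card_eq_card (Finset.filter_subset (i + 2 * R < ·) S)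
    nlinarith
  set E := S.filter (i + 2 * R < ·) with hE
  have e1 : (((1 / 2 : ℝ) ^ 18) ^ E.card) ^ 2 ≤ ((1 / 2 : ℝ) ^ (9 * d)) ^ 2 := by
    rw [← pow_mul, ← pow_mul, ← pow_mul]
    exact pow_le_pow_of_le_one (by norm_num) (by norm_num) (by nlinarith)
  have e2 : ((1 / 2 : ℝ) ^ 18) ^ E.card ≤ (1 / 2 : ℝ) ^ (9 * d) :=
    (sq_le_sq₀ (by positivity) (by positivity)).1 e1
  have e3 : (1 / 2 : ℝ) ^ κ / 8 < 1 / (4 * r) - 2 * Real.exp (-(ρ ^ 2 / (4 * lam))) := by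
    have : (1 / 2 : ℝ) ^ κ / 4 < 1 / (4 * r) := by
      rw [one_div, inv_pow, div_eq_inv_mul, one_div, mul_inv]
      exact mul_lt_mul_of_pos_left (inv_strictAnti₀ hr0 hrκ) (by norm_num)
    linarith
  have e4 : (1 / 2 : ℝ) ^ (9 * d) ≤ (1 / 32) ^ d * ((1 / 2 : ℝ) ^ κ / 8) := by
    have : (1 / 32 : ℝ) ^ d * ((1 / 2 : ℝ) ^ κ / 8) = (1 / 2) ^ (5 * d + κ + 3) := by
      rw [pow_add, pow_add, pow_mul]
      norm_num
      ring
    rw [this]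
    exact pow_le_pow_of_le_one (by norm_num) (by norm_num) (by omega)
  have e5 := mul_lt_mul_of_pos_left e3 (show (0 : ℝ) < (1 / 32) ^ d by positivity)
  linarith

theorem two_mul_exp_neg_le {κ : ℕ} {a : ℝ} (ha : (κ : ℝ) + 4 ≤ a) :
    2 * Real.exp (-a) ≤ (1 / 2) ^ κ / 8 := by
  have h1 : Real.exp (-a) ≤ (1 / 2) ^ (κ + 4) := by
    calc Real.exp (-a) ≤ Real.exp (((κ + 4 : ℕ) : ℝ) * (-1)) := by
          refine Real.exp_le_exp.2 ?_
          push_cast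
          linarith
      _ = Real.exp (-1) ^ (κ + 4) := Real.exp_nat_mul _ _
      _ ≤ _ := by
          refine pow_le_pow_left₀ (Real.exp_pos _).le ?_ _
          rw [Real.exp_neg, one_div]
          refine inv_anti₀ (by norm_num) ?_
          have := Real.add_one_le_exp (1 : ℝ)
          linarith
  rw [pow_add] at h1
  linarith

set_option maxHeartbeats 1000000 in
/-- The rank bound from a cluster of sign changes: either the cluster has no dense window, or one
passes to a dense window and uses larger blocks. -/
theorem two_pow_le_rank_of_cluster {n r w L κ W Δ : ℕ} {D : ℕ → ℤ} (hr : 0 < r)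
    (hW1 : 1 ≤ W) (hW : 4 / (W : ℝ) ≤ ((1 / 2) ^ 18) ^ 2)
    (U V : (Fin n → Bool) → Fin r → ℝ)
    (hUV : ∀ x y, 0 < (∑ i, U x i * V y i) * (D (hamW (band x y)) : ℝ))
    (hD : ∀ j ≤ n, D j = 1 ∨ D j = -1) {Z : Finset ℕ} (hchange : ∀ s ∈ Z, D s ≠ D (s + 1))
    (hsep : ∀ s ∈ Z, ∀ s' ∈ Z, s < s' → s + 2 ≤ s') (hw : ∀ s ∈ Z, w ≤ s ∧ s + w ≤ n)
    (hL : 2 ≤ L) (hn : n ≤ 2 ^ L) (hκ : 1 ≤ κ) (hΔ : ∀ s ∈ Z, ∀ s' ∈ Z, s' ≤ s + Δ)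
    (hΔw : 10 * W * Δ ≤ w) (hcard : 2 ^ 15 * κ * L ^ 3 * (L + 1) ≤ Z.card) :
    2 ^ κ ≤ r := by
  have hZ1 : 2 ^ 15 * κ ≤ Z.card := by
    refine le_trans ?_ hcard
    rw [mul_assoc]
    exact Nat.le_mul_of_pos_right _ (by positivity)
  have hZΔ : Z.card ≤ Δ + 1 := by
    obtain ⟨s, hs⟩ : Z.Nonempty := Finset.card_pos.1 (by omega)
    have hmin := Finset.min'_mem Z ⟨s, hs⟩
    have : Z ⊆ Finset.Icc (Z.min' ⟨s, hs⟩) (Z.min' ⟨s, hs⟩ + Δ) := fun u hu =>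
      Finset.mem_Icc.2 ⟨Finset.min'_le _ _ hu, hΔ _ hmin u hu⟩
    have := Finset.card_le_card this
    rw [Nat.card_Icc] at this
    omega
  have hκΔ : 10000 * κ ≤ Δ := by omega
  have hdiam : ∀ s ∈ Z, ∀ s' ∈ Z, |(s : ℝ) - s'| ≤ 2 ^ L := by
    intro s hs s' hs'
    have h1 : (s : ℝ) ≤ 2 ^ L := by exact_mod_cast (by have := hw s hs; omega : s ≤ n).trans hn
    have h2 : (s' : ℝ) ≤ 2 ^ L := by exact_mod_cast (by have := hw s' hs'; omega : s' ≤ n).trans hn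
    have h3 : (0 : ℝ) ≤ s := by positivity
    have h4 : (0 : ℝ) ≤ s' := by positivity
    rw [abs_le]
    constructor <;> linarith
  have hWr : (1 : ℝ) ≤ W := by exact_mod_cast hW1
  have hκr : (1 : ℝ) ≤ κ := by exact_mod_cast hκ
  have hΔr : (10000 : ℝ) * κ ≤ Δ := by exact_mod_cast hκΔ
  have hwr : (10 : ℝ) * W * Δ ≤ w := by exact_mod_cast hΔw
  have hwκ : 100000 * W * κ ≤ (w : ℝ) := by nlinarith
  obtain ⟨m, hm⟩ : ∃ m, m = w / (2 * W) := ⟨_, rfl⟩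
  have hmle : m * (2 * W) ≤ w := hm ▸ Nat.div_mul_le_self _ _
  have hmlt : w < (m + 1) * (2 * W) := by
    rw [hm]; exact Nat.lt_mul_of_div_lt (Nat.lt_succ_self _) (by omega)
  have hmler : (m : ℝ) * (2 * W) ≤ w := by exact_mod_cast hmle
  have hmltr : (w : ℝ) < (m + 1) * (2 * W) := by exact_mod_cast hmlt
  have hmΔ : 5 * Δ ≤ m + 1 := by
    by_contra hcon
    have : m + 1 + 1 ≤ 5 * Δ := by omega
    have := Nat.mul_le_mul_right (2 * W) this
    nlinarith
  have hmr : (5 : ℝ) * Δ ≤ m + 1 := by exact_mod_cast hmΔ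
  set ρ : ℝ := √(2 * m * (κ + 4)) with hρ
  have hρ2 : ρ ^ 2 = 2 * m * (κ + 4) := Real.sq_sqrt (by positivity)
  have hρ0 : 0 ≤ ρ := Real.sqrt_nonneg _
  have hρ1 : 1 ≤ ρ := by
    rw [hρ]
    refine Real.one_le_sqrt.2 ?_
    nlinarith
  have hm0 : (0 : ℝ) < m := by linarith
  have hρm : ρ ≤ m := by
    refine Real.sqrt_le_iff.2 ⟨hm0.le, ?_⟩
    nlinarith
  set R := ⌈ρ⌉₊ + 2 with hR
  have hRle : (R : ℝ) ≤ ρ + 3 := by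
    have := Nat.ceil_lt_add_one hρ0
    rw [hR]; push_cast; linarith
  have hleR : ρ + 2 ≤ R := by
    have := Nat.le_ceil ρ
    rw [hR]; push_cast; linarith
  by_cases hsparse : ∀ a ∈ Z,
      L * (Z.filter fun s => a ≤ s ∧ s ≤ a + 2 * R).card ≤ 2 ^ 15 * κ * L ^ 3
  · have hlam : (m : ℝ) / 2 = m * ((W : ℝ) / (2 * W : ℕ)) := by
      push_cast
      field_simp
    refine two_pow_le_rank_of_sparse hr hW1 hW U V hUV hD hchange hsep hw le_rfl (by omega) hmle
      ?_ hL hdiam hcard ?_ ?_ hsparse hlam hρ0 (by linarith) hleR ?_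
    · intro s hs s' hs'
      have := hΔ s hs s' hs'
      omega
    · have : 1 ≤ L ^ 3 := Nat.one_le_pow _ _ (by omega)
      nlinarith
    · have : 1 ≤ L ^ 3 := Nat.one_le_pow _ _ (by omega)
      nlinarith
    · refine two_mul_exp_neg_le ?_
      rw [hρ2, le_div_iff₀ (by linarith)]
      linarith
  · push Not at hsparse
    obtain ⟨a, -, ha⟩ := hsparse
    set Z' := Z.filter fun s => a ≤ s ∧ s ≤ a + 2 * R with hZ'
    have hsub : Z' ⊆ Z := Finset.filter_subset _ _
    have hZ'card : 2 ^ 15 * κ * L ^ 2 ≤ Z'.card := by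
      by_contra hcon
      have := Nat.mul_le_mul_left L (not_le.1 hcon).le
      have : L * (2 ^ 15 * κ * L ^ 2) = 2 ^ 15 * κ * L ^ 3 := by ring
      omega
    set m' := 4 * R + 2 with hm'
    have hm'0 : (0 : ℝ) < m' := by rw [hm']; positivity
    have hm'le : (m' : ℝ) ≤ 18 * ρ := by rw [hm']; push_cast; linarith
    have hlem' : 4 * ρ ≤ (m' : ℝ) := by rw [hm']; push_cast; linarith
    obtain ⟨ℓ, hℓ⟩ : ∃ ℓ, ℓ = w / m' := ⟨_, rfl⟩
    have hℓle : m' * ℓ ≤ w := hℓ ▸ Nat.mul_div_le _ _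
    have hℓlt : w < (ℓ + 1) * m' := by
      rw [hℓ]; exact Nat.lt_mul_of_div_lt (Nat.lt_succ_self _) (by omega)
    have hℓler : (m' : ℝ) * ℓ ≤ w := by exact_mod_cast hℓle
    have hℓltr : (w : ℝ) < (ℓ + 1) * m' := by exact_mod_cast hℓlt
    have hw0 : (0 : ℝ) < w := by nlinarith
    have hm'sq : (m' : ℝ) ^ 2 * W ≤ 324 * (κ + 4) * w := by
      calc (m' : ℝ) ^ 2 * W ≤ (18 * ρ) ^ 2 * (W : ℝ) := by gcongr
        _ = (324 * (κ + 4) * (m * (2 * W)) : ℝ) := by rw [mul_pow, hρ2]; ring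
        _ ≤ _ := by gcongr
    have hm'w : 2 * W * (m' : ℝ) ≤ w := by
      refine (sq_le_sq₀ (by positivity) hw0.le).1 ?_
      calc (2 * W * (m' : ℝ)) ^ 2 = 4 * W * (m' ^ 2 * W) := by ring
        _ ≤ (4 * W * (324 * (κ + 4) * w) : ℝ) := by gcongr
        _ = (1296 * (κ + 4) : ℝ) * (W * w) := by ring
        _ ≤ (100000 * κ : ℝ) * (W * w) :=
          mul_le_mul_of_nonneg_right (by linarith) (by positivity)
        _ = (100000 * W * κ) * w := by ring
        _ ≤ w * w := mul_le_mul_of_nonneg_right hwκ hw0.le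
        _ = (w : ℝ) ^ 2 := by ring
    have hℓW : 2 * W ≤ ℓ := by
      rw [hℓ, Nat.le_div_iff_mul_le (by omega)]
      exact_mod_cast hm'w
    have hℓWr : (2 : ℝ) * W ≤ ℓ := by exact_mod_cast hℓW
    have hℓ0 : (0 : ℝ) < ℓ := by linarith
    have hw2 : (w : ℝ) ≤ 2 * (m' * ℓ) := by nlinarith
    obtain ⟨lam, hlam⟩ : ∃ lam : ℝ, lam = m' * ((W : ℝ) / ℓ) := ⟨_, rfl⟩
    have hlamℓ : lam * (m' * ℓ) = m' ^ 2 * W := by rw [hlam]; field_simp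
    have hlow : (κ : ℝ) + 4 ≤ lam := by
      have h1 : (4 * ρ) ^ 2 * W ≤ m' ^ 2 * W := by gcongr
      rw [mul_pow, hρ2] at h1
      by_contra hcon
      have h2 : lam * (m' * ℓ) ≤ (κ + 4) * w :=
        mul_le_mul (not_le.1 hcon).le hℓler (by positivity) (by positivity)
      have h3 : (w : ℝ) < 4 * W * m := by nlinarith
      have h4 : (κ + 4) * (w : ℝ) < (κ + 4) * (4 * W * m) := by gcongr
      nlinarith [mul_pos (mul_pos (by linarith : (0 : ℝ) < κ + 4) hm0) (by linarith : (0 : ℝ) < W)]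
    have hhigh : lam ≤ 648 * (κ + 4) := by
      have h1 : lam * (m' * ℓ) ≤ 648 * (κ + 4) * (m' * ℓ) := by
        rw [hlamℓ]
        nlinarith
      exact le_of_mul_le_mul_right h1 (by positivity)
    obtain ⟨R', hR'⟩ : ∃ R', R' = ⌈2 * lam⌉₊ + 2 := ⟨_, rfl⟩
    have hR'le : R' ≤ 6500 * κ := by
      have h1 := Nat.ceil_lt_add_one (show 0 ≤ 2 * lam by linarith)
      have h2 : (R' : ℝ) ≤ 6500 * κ := by
        rw [hR']; push_cast; linarith
      exact_mod_cast h2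
    have hleR' : 2 * lam + 2 ≤ R' := by
      have := Nat.le_ceil (2 * lam)
      rw [hR']; push_cast; linarith
    refine two_pow_le_rank_of_sparse (Z := Z') (d := 2 ^ 14 * κ * L) hr hW1 hW U V hUV hD
      (fun s hs => hchange s (hsub hs)) (fun s hs s' hs' => hsep s (hsub hs) s' (hsub hs'))
      (fun s hs => hw s (hsub hs)) hℓW (by omega) hℓle ?_ hL
      (fun s hs s' hs' => hdiam s (hsub hs) s' (hsub hs')) ?_ ?_ ?_ ?_ hlam
      (by linarith) le_rfl hleR' ?_
    · intro s hs s' hs'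
      rw [hZ', Finset.mem_filter] at hs hs'
      omega
    · refine le_trans ?_ hZ'card
      have : L + 1 ≤ 2 * L := by omega
      calc 2 ^ 14 * κ * L * (L + 1) ≤ 2 ^ 14 * κ * L * (2 * L) := Nat.mul_le_mul_left _ this
        _ = _ := by ring
    · nlinarith
    · nlinarith
    · intro b _
      have h1 : (Z'.filter fun s => b ≤ s ∧ s ≤ b + 2 * R') ⊆ Finset.Icc b (b + 2 * R') := by
        intro s hs
        rw [Finset.mem_filter] at hs
        exact Finset.mem_Icc.2 hs.2
      have h2 := Finset.card_le_card h1
      rw [Nat.card_Icc] at h2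
      calc L * _ ≤ L * (2 ^ 14 * κ) := Nat.mul_le_mul_left _ (by omega)
        _ = _ := by ring
    · refine two_mul_exp_neg_le ?_
      have : (2 * lam) ^ 2 / (4 * lam) = lam := by
        have : lam ≠ 0 := by linarith
        field_simp
        ring
      rw [this]
      exact hlow

theorem mul_dist_le_of_div_eq {N j u u' : ℕ} (hN : 1 ≤ N) (h : N * u / 2 ^ j = N * u' / 2 ^ j)
    (hle : u ≤ u') : u' ≤ u + 2 ^ j / N := by
  have h1 := Nat.div_add_mod (N * u) (2 ^ j)
  have h2 := Nat.div_add_mod (N * u') (2 ^ j)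
  have h3 := Nat.mod_lt (N * u') (show 0 < 2 ^ j by positivity)
  rw [h] at h1
  have h4 : (u' - u) * N ≤ 2 ^ j := by
    rw [Nat.sub_mul, mul_comm u', mul_comm u]
    omega
  have := (Nat.le_div_iff_mul_le hN).2 h4
  omega

/-- A large subset of `Z` whose diameter is small compared to the distance to `0` and `n`. -/
theorem exists_cluster {n L N K : ℕ} (hN : 1 ≤ N) (hn : n ≤ 2 ^ L) (Z : Finset ℕ)
    (hZ : ∀ s ∈ Z, 1 ≤ s ∧ s < n) (hcard : 8 * N * (L + 1) * K ≤ Z.card) :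
    ∃ Z' ⊆ Z, ∃ w Δ, K ≤ Z'.card ∧ (∀ s ∈ Z', w ≤ s ∧ s + w ≤ n) ∧ N * Δ ≤ w ∧
      (∀ s ∈ Z', ∀ s' ∈ Z', s' ≤ s + Δ) ∧ ∀ s ∈ Z', ∀ s' ∈ Z', s < s' → s + 2 ≤ s' := by
  classical
  set f : ℕ → ℕ × ℕ × Bool × ℕ := fun s =>
    (Nat.log 2 (min s (n - s)), N * min s (n - s) / 2 ^ Nat.log 2 (min s (n - s)),
      decide (s ≤ n - s), s % 2) with hf
  have hmaps : ∀ s ∈ Z, f s ∈ Finset.range (L + 1) ×ˢ Finset.range (2 * N) ×ˢ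
      (Finset.univ : Finset Bool) ×ˢ Finset.range 2 := by
    intro s hs
    have h := hZ s hs
    have hu : min s (n - s) ≠ 0 := by omega
    simp only [hf, Finset.mem_product, Finset.mem_range, Finset.mem_univ, true_and]
    refine ⟨?_, ?_, Nat.mod_lt _ (by norm_num)⟩
    · refine Nat.lt_succ_of_le ?_
      calc Nat.log 2 (min s (n - s)) ≤ Nat.log 2 (2 ^ L) := Nat.log_mono_right (by omega)
        _ = L := Nat.log_pow (by norm_num) L
    · have h1 := Nat.lt_pow_succ_log_self (b := 2) (by norm_num) (min s (n - s))
      rw [Nat.div_lt_iff_lt_mul (by positivity)]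
      rw [pow_succ] at h1
      nlinarith
  by_cases hK : Z = ∅
  · refine ⟨∅, Finset.empty_subset _, 0, 0, ?_, by simp, by simp, by simp, by simp⟩
    rw [hK, Finset.card_empty] at hcard
    have : 0 < 8 * N * (L + 1) := by positivity
    rw [Finset.card_empty]
    by_contra hcon
    have := Nat.mul_pos this (not_le.1 hcon)
    omega
  obtain ⟨s₀, hs₀⟩ := Finset.nonempty_iff_ne_empty.2 hK
  obtain ⟨b, -, hb⟩ := Finset.exists_le_card_fiber_of_mul_le_card_of_maps_to (n := K) hmaps
    ⟨_, hmaps s₀ hs₀⟩ (by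
      simp only [Finset.card_product, Finset.card_range, Finset.card_univ, Fintype.card_bool]
      refine le_trans (le_of_eq ?_) hcard
      ring)
  have hmem : ∀ s ∈ Z.filter (fun s => f s = b), 1 ≤ s ∧ s < n ∧
      Nat.log 2 (min s (n - s)) = b.1 ∧ N * min s (n - s) / 2 ^ b.1 = b.2.1 ∧
      decide (s ≤ n - s) = b.2.2.1 ∧ s % 2 = b.2.2.2 := by
    intro s hs
    rw [Finset.mem_filter] at hs
    obtain ⟨h1, rfl⟩ := hs
    exact ⟨(hZ s h1).1, (hZ s h1).2, rfl, rfl, rfl, rfl⟩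
  refine ⟨Z.filter fun s => f s = b, Finset.filter_subset _ _, 2 ^ b.1, 2 ^ b.1 / N, hb, ?_,
    Nat.mul_div_le _ _, ?_, ?_⟩
  · intro s hs
    obtain ⟨h1, h2, h3, -⟩ := hmem s hs
    have := Nat.pow_log_le_self 2 (show min s (n - s) ≠ 0 by omega)
    rw [h3] at this
    omega
  · intro s hs s' hs'
    obtain ⟨h1, h2, -, h3, h4, -⟩ := hmem s hs
    obtain ⟨h1', h2', -, h3', h4', -⟩ := hmem s' hs'
    have h5 : (s ≤ n - s) ↔ (s' ≤ n - s') := by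
      rw [← h4'] at h4
      exact decide_eq_decide.1 h4
    have a1 := fun h => mul_dist_le_of_div_eq hN (h3.trans h3'.symm) h
    have a2 := fun h => mul_dist_le_of_div_eq hN (h3'.trans h3.symm) h
    rcases le_total (min s (n - s)) (min s' (n - s')) with h | h
    · have := a1 h
      omega
    · have := a2 h
      omega
  · intro s hs s' hs' h
    obtain ⟨-, -, -, -, -, h1⟩ := hmem s hs
    obtain ⟨-, -, -, -, -, h2⟩ := hmem s' hs'
    omega

theorem hamW_band_initial {n a b : ℕ} (hab : min a b ≤ n) :
    hamW (band (fun i : Fin n => decide ((i : ℕ) < a)) fun i => decide ((i : ℕ) < b)) =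
      min a b := by
  have : ∀ i : Fin n, (band (fun i : Fin n => decide ((i : ℕ) < a))
      (fun i => decide ((i : ℕ) < b)) i = true) ↔ (i : ℕ) < min a b := by
    intro i
    simp [band]
  simp only [hamW, this]
  rw [← Fintype.card_subtype]
  have h := Fintype.card_congr (Fin.castLEquiv hab :
    Fin (min a b) ≃ {i : Fin n // (i : ℕ) < min a b})
  rw [← h, Fintype.card_fin]

theorem two_le_rank_of_change {n r i : ℕ} {D : ℕ → ℤ}
    (U V : (Fin n → Bool) → Fin r → ℝ)
    (hUV : ∀ x y, 0 < (∑ i, U x i * V y i) * (D (hamW (band x y)) : ℝ))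
    (hD : ∀ j ≤ n, D j = 1 ∨ D j = -1) (hi : i < n) (hne : D i ≠ D (i + 1)) : 2 ≤ r := by
  by_contra hcon
  have hr : r = 0 ∨ r = 1 := by omega
  have key : ∀ a b, a = i ∨ a = i + 1 → b = i ∨ b = i + 1 → 0 < (∑ j,
      U (fun k : Fin n => decide ((k : ℕ) < a)) j * V (fun k => decide ((k : ℕ) < b)) j) *
        (D (min a b) : ℝ) := by
    intro a b ha hb
    have h := hUV (fun k : Fin n => decide ((k : ℕ) < a)) fun k => decide ((k : ℕ) < b)
    rwa [hamW_band_initial (by omega)] at h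
  have k1 := key i i (by simp) (by simp)
  have k2 := key i (i + 1) (by simp) (by simp)
  have k3 := key (i + 1) i (by simp) (by simp)
  have k4 := key (i + 1) (i + 1) (by simp) (by simp)
  rcases hr with rfl | rfl
  · simp at k1
  · simp only [Finset.univ_unique, Finset.sum_singleton, min_self, Nat.le_add_right, inf_of_le_left,
      inf_of_le_right] at k1 k2 k3 k4
    have hprod : (D i : ℝ) * D (i + 1) = -1 := by
      rcases hD i hi.le with h | h <;> rcases hD (i + 1) hi with h' | h' <;>
        first | (exact absurd (h.trans h'.symm) hne) | (rw [h, h']; norm_num)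
    have hsq : (D i : ℝ) * D i = 1 := by
      rcases hD i hi.le with h | h <;> rw [h] <;> norm_num
    set u1 := U (fun k : Fin n => decide ((k : ℕ) < i)) default
    set u2 := U (fun k : Fin n => decide ((k : ℕ) < i + 1)) default
    set v1 := V (fun k : Fin n => decide ((k : ℕ) < i)) default
    set v2 := V (fun k : Fin n => decide ((k : ℕ) < i + 1)) default
    have p1 := mul_pos k1 k4
    have p2 := mul_pos k2 k3
    have e1 : u1 * v1 * (D i : ℝ) * (u2 * v2 * D (i + 1)) = -(u1 * v1 * u2 * v2) := by
      calc _ = u1 * v1 * u2 * v2 * ((D i : ℝ) * D (i + 1)) := by ring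
        _ = _ := by rw [hprod]; ring
    have e2 : u1 * v2 * (D i : ℝ) * (u2 * v1 * D i) = u1 * v1 * u2 * v2 := by
      calc _ = u1 * v1 * u2 * v2 * ((D i : ℝ) * D i) := by ring
        _ = _ := by rw [hsq]; ring
    linarith

theorem exists_sign_factorization {n : ℕ} {D : ℕ → ℤ} (hD : ∀ j ≤ n, D j = 1 ∨ D j = -1) :
    ∃ (r : ℕ) (U V : (Fin n → Bool) → Fin r → ℝ),
      signRank (fun x y : Fin n → Bool => (D (hamW (band x y)) : ℝ)) = r ∧
        ∀ x y, 0 < (∑ i, U x i * V y i) * (D (hamW (band x y)) : ℝ) := by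
  have hne : {r : ℕ | ∃ A : Matrix (Fin n → Bool) (Fin n → Bool) ℝ,
      (∀ x y, 0 < A x y * (D (hamW (band x y)) : ℝ)) ∧ A.rank = r}.Nonempty := by
    refine ⟨_, fun x y => (D (hamW (band x y)) : ℝ), fun x y => ?_, rfl⟩
    have hle : hamW (band x y) ≤ n := by
      have := Finset.card_le_univ (Finset.univ.filter fun i => band x y i = true)
      rwa [Fintype.card_fin] at this
    change 0 < (D (hamW (band x y)) : ℝ) * (D (hamW (band x y)) : ℝ)
    rcases hD _ hle with h | h <;> rw [h] <;> norm_num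
  obtain ⟨A, hA, hrank⟩ := Nat.sInf_mem hne
  obtain ⟨U, V, hUV⟩ := exists_rank_factorization A
  exact ⟨A.rank, U, V, hrank.symm, fun x y => by rw [← hUV]; exact hA x y⟩

theorem two_pow_le_rank {n r L κ : ℕ} {D : ℕ → ℤ} (hr : 0 < r)
    (U V : (Fin n → Bool) → Fin r → ℝ)
    (hUV : ∀ x y, 0 < (∑ i, U x i * V y i) * (D (hamW (band x y)) : ℝ))
    (hD : ∀ j ≤ n, D j = 1 ∨ D j = -1) (hL : 2 ≤ L) (hn : n ≤ 2 ^ L) (hκ : 1 ≤ κ)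
    (hk : 2 ^ 62 * κ * L ^ 5 + 1 ≤
      ((Finset.range n).filter fun i => D i ≠ D (i + 1)).card) : 2 ^ κ ≤ r := by
  obtain ⟨W, hW⟩ : ∃ W : ℕ, W = 2 ^ 38 := ⟨_, rfl⟩
  set C := (Finset.range n).filter fun i => D i ≠ D (i + 1) with hC
  have hCmem : ∀ s ∈ C.erase 0, 1 ≤ s ∧ s < n := fun s hs => by
    have h1 := Finset.ne_of_mem_erase hs
    have h2 := Finset.mem_of_mem_erase hs
    rw [hC, Finset.mem_filter, Finset.mem_range] at h2
    omega
  have hCc : 2 ^ 62 * κ * L ^ 5 ≤ (C.erase 0).card := by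
    have := Finset.pred_card_le_card_erase (s := C) (a := 0)
    omega
  have hcount : 8 * (10 * W) * (L + 1) * (2 ^ 15 * κ * L ^ 3 * (L + 1)) ≤ (C.erase 0).card := by
    refine le_trans ?_ hCc
    have h2 : L + 1 ≤ 2 * L := by omega
    calc 8 * (10 * W) * (L + 1) * (2 ^ 15 * κ * L ^ 3 * (L + 1))
        ≤ 8 * (10 * W) * (2 * L) * (2 ^ 15 * κ * L ^ 3 * (2 * L)) := by gcongr
      _ = 8 * 10 * 4 * 2 ^ 15 * W * (κ * L ^ 5) := by ring
      _ ≤ 2 ^ 62 * (κ * L ^ 5) := Nat.mul_le_mul_right _ (by rw [hW]; norm_num)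
      _ = _ := by ring
  obtain ⟨Z, hZC, w, Δ, hK, hw, hΔw, hΔ, hsep⟩ :=
    exists_cluster (by omega) hn (C.erase 0) hCmem hcount
  refine two_pow_le_rank_of_cluster hr (by omega) (by rw [hW]; norm_num) U V hUV hD
    (fun s hs => ?_) hsep hw hL hn hκ hΔ hΔw hK
  have := Finset.mem_of_mem_erase (hZC hs)
  rw [hC, Finset.mem_filter] at this
  exact this.2

/-- Sherstov's theorem (lower bound): for the symmetric AND function
`F(x,y) = D(|x ∧ y|)`, `log₂ rk±(F) ≥ c · deg(D) / (log₂ n)^5` for a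
universal constant `c > 0`, where `deg(D)` is the number of sign changes of `D`. -/
theorem and_signRank_lower_bound :
    ∃ c : ℝ, 0 < c ∧ ∀ n : ℕ, 2 ≤ n → ∀ D : ℕ → ℤ,
      (∀ i ≤ n, D i = 1 ∨ D i = -1) →
      c * (((Finset.range n).filter (fun i => D i ≠ D (i + 1))).card : ℝ) /
          (Real.logb 2 n) ^ 5 ≤
        Real.logb 2
          (signRank (fun x y : Fin n → Bool => (D (hamW (band x y)) : ℝ))) := by
  obtain ⟨B, hB⟩ : ∃ B : ℕ, B = 2 ^ 62 := ⟨_, rfl⟩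
  have hB0 : (0 : ℝ) < B := by rw [hB]; norm_num
  refine ⟨1 / (64 * B), by positivity, fun n hn D hD => ?_⟩
  obtain ⟨r, U, V, hsr, hUV⟩ := exists_sign_factorization hD
  rw [hsr]
  set k := ((Finset.range n).filter fun i => D i ≠ D (i + 1)).card with hk
  have hr : 0 < r := by
    by_contra hcon
    have h0 : r = 0 := by omega
    have := hUV (fun _ => true) fun _ => true
    have hemp : (Finset.univ : Finset (Fin r)) = ∅ := by
      rw [← Finset.card_eq_zero, Finset.card_univ, Fintype.card_fin, h0]
    rw [hemp, Finset.sum_empty, zero_mul] at this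
    exact lt_irrefl _ this
  have hr1 : (1 : ℝ) ≤ r := by exact_mod_cast hr
  set lg := Real.logb 2 n with hlg
  have hn2 : (2 : ℝ) ≤ n := by exact_mod_cast hn
  have hlg1 : 1 ≤ lg := by
    rw [hlg, Real.le_logb_iff_rpow_le (by norm_num) (by linarith), Real.rpow_one]
    exact hn2
  rcases Nat.eq_zero_or_pos k with hk0 | hkpos
  · rw [hk0, Nat.cast_zero, mul_zero, zero_div]
    exact Real.logb_nonneg (by norm_num) hr1
  have hr2 : 2 ≤ r := by
    obtain ⟨i, hi⟩ := Finset.card_pos.1 hkpos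
    rw [Finset.mem_filter, Finset.mem_range] at hi
    exact two_le_rank_of_change U V hUV hD hi.1 hi.2
  obtain ⟨L, hL⟩ : ∃ L, L = Nat.log 2 n + 1 := ⟨_, rfl⟩
  have hL2 : 2 ≤ L := by
    have := (Nat.le_log_iff_pow_le (b := 2) (by norm_num) (show n ≠ 0 by omega) (x := 1)).2
      (by omega)
    omega
  have hnL : n ≤ 2 ^ L := hL ▸ (Nat.lt_pow_succ_log_self (by norm_num) n).le
  have hLlg : (L : ℝ) ≤ 2 * lg := by
    have h1 : ((Nat.log 2 n : ℕ) : ℝ) ≤ lg := by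
      rw [hlg, Real.le_logb_iff_rpow_le (by norm_num) (by linarith), Real.rpow_natCast]
      exact_mod_cast Nat.pow_log_le_self 2 (by omega)
    rw [hL]
    push_cast
    linarith
  have hL5 : (L : ℝ) ^ 5 ≤ 32 * lg ^ 5 := by
    calc (L : ℝ) ^ 5 ≤ (2 * lg) ^ 5 := by gcongr
      _ = _ := by ring
  set κ := (k - 1) / (B * L ^ 5) with hκ
  have hBL : 0 < B * L ^ 5 := by
    have : 0 < B := by rw [hB]; norm_num
    positivity
  have hkκ : k ≤ (κ + 1) * (B * L ^ 5) := by
    have := Nat.lt_mul_of_div_lt (Nat.lt_succ_self κ) hBL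
    have : k - 1 < (κ + 1) * (B * L ^ 5) := this
    omega
  have hkκr : (k : ℝ) ≤ (κ + 1) * (B * L ^ 5) := by exact_mod_cast hkκ
  have hmax : max 1 (κ : ℝ) ≤ Real.logb 2 r := by
    refine max_le ?_ ?_
    · rw [Real.le_logb_iff_rpow_le (by norm_num) (by linarith), Real.rpow_one]
      exact_mod_cast hr2
    · rw [Real.le_logb_iff_rpow_le (by norm_num) (by linarith), Real.rpow_natCast]
      rcases Nat.eq_zero_or_pos κ with h0 | h0
      · rw [h0, pow_zero]; exact hr1
      · have : κ * (B * L ^ 5) ≤ k - 1 := Nat.div_mul_le_self _ _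
        have h3 : 2 ^ 62 * κ * L ^ 5 + 1 ≤ k := by
          rw [← hB]
          have : B * κ * L ^ 5 = κ * (B * L ^ 5) := by ring
          omega
        exact_mod_cast two_pow_le_rank hr U V hUV hD hL2 hnL h0 h3
  refine le_trans ?_ hmax
  have hmax2 : (κ : ℝ) + 1 ≤ 2 * max 1 (κ : ℝ) := by
    have := le_max_left 1 (κ : ℝ)
    have := le_max_right 1 (κ : ℝ)
    linarith
  rw [div_le_iff₀ (by positivity), one_div, inv_mul_le_iff₀ (by positivity)]
  calc (k : ℝ) ≤ (κ + 1) * (B * L ^ 5) := hkκr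
    _ ≤ 2 * max 1 (κ : ℝ) * (B * (32 * lg ^ 5)) := by gcongr
    _ = _ := by ring
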